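/- arXiv:1108.3685 — 2 statements merged into one kernel-verified Lean document; each statement's English description precedes it below -/
import Mathlib

section
/- Let K = (k(1),...,k(n)) ∈ ℕ^n with K ≠ 0 and d^K = ∏_{i=1}^{n} d_{n,i}^{k(i)}. Then there exist a finite sequence of natural numbers c_1,...,c_r, a natural number m, and a unit u ∈ F_p^× such that (P^{p^{c_1}} ∘ P^{p^{c_2}} ∘ ... ∘ P^{p^{c_r}})(d^K) = u · d_{n,n}^{p^m}. -/
open MvPolynomial Matrix

/-- The algebra automorphism of `F_p[y_1,...,y_n]` induced by `g ∈ GL_n(F_p)`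
(linear substitution of the variables: `y_i ↦ ∑_j g_{j i} y_j`). -/
noncomputable def glAct (p n : ℕ) (g : GL (Fin n) (ZMod p)) :
    MvPolynomial (Fin n) (ZMod p) →ₐ[ZMod p] MvPolynomial (Fin n) (ZMod p) :=
  aeval fun i => ∑ j, C ((g : Matrix (Fin n) (Fin n) (ZMod p)) j i) * X j

/-- The total Steenrod operation `P_t`, the algebra homomorphism with
`P_t(y_i) = y_i + y_i^p t`. -/
noncomputable def Pt (p n : ℕ) :
    MvPolynomial (Fin n) (ZMod p) →ₐ[ZMod p] Polynomial (MvPolynomial (Fin n) (ZMod p)) :=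
  aeval fun i => Polynomial.C (X i) + Polynomial.C (X i ^ p) * Polynomial.X

/-- The Steenrod operation `P^k`: the coefficient of `t^k` in `P_t(f)`. -/
noncomputable def steenrod (p n k : ℕ) (f : MvPolynomial (Fin n) (ZMod p)) :
    MvPolynomial (Fin n) (ZMod p) :=
  (Pt p n f).coeff k

/-- The Dickson invariant `d_{n,i}`, defined from the identity
`∏_{v ∈ F_p^n} (X + v·y) = ∑_{i=0}^n (-1)^i d_{n,i} X^{p^{n-i}}`. -/
noncomputable def dickson (p n i : ℕ) [NeZero p] : MvPolynomial (Fin n) (ZMod p) :=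
  (-1) ^ i *
    (∏ v : Fin n → ZMod p,
      (Polynomial.X + Polynomial.C (∑ j, C (v j) * X j))).coeff (p ^ (n - i))

/-- The iterated Steenrod operation `P(c,j) = P^{p^{c-j+1}} ∘ ⋯ ∘ P^{p^{c-1}} ∘ P^{p^c}`
(`P^{p^c}` applied first). -/
noncomputable def Pcj (p n c : ℕ) : ℕ → MvPolynomial (Fin n) (ZMod p) → MvPolynomial (Fin n) (ZMod p)
  | 0 => id
  | j + 1 => fun f => steenrod p n (p ^ (c + 1 - (j + 1))) (Pcj p n c j f)

/-- Apply the composite `P^{p^{s_1}} ∘ P^{p^{s_2}} ∘ ⋯ ∘ P^{p^{s_r}}` (last entry applied first). -/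
noncomputable def steenrodList (p n : ℕ) :
    List ℕ → MvPolynomial (Fin n) (ZMod p) → MvPolynomial (Fin n) (ZMod p)
  | [] => id
  | s :: rest => fun f => steenrod p n (p ^ s) (steenrodList p n rest f)

/-- Over a domain of characteristic `p`, `∏_{a ∈ F_p} (z + a w) = z^p - w^{p-1} z`. -/
theorem prod_add_algebraMap_mul {p : ℕ} [Fact p.Prime] {A : Type*} [CommRing A] [IsDomain A]
    [Algebra (ZMod p) A] (z w : A) :
    ∏ a : ZMod p, (z + algebraMap (ZMod p) A a * w) = z ^ p - w ^ (p - 1) * z := by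
  have hp : p.Prime := Fact.out
  have hroots : ∏ a : ZMod p, (Polynomial.X - Polynomial.C a) =
      (Polynomial.X ^ p - Polynomial.X : Polynomial (ZMod p)) := by
    have hmonic : (Polynomial.X ^ p - Polynomial.X : Polynomial (ZMod p)).Monic :=
      Polynomial.monic_X_pow_sub (by simpa using hp.one_lt)
    have h := FiniteField.roots_X_pow_card_sub_X (ZMod p)
    rw [ZMod.card] at h
    have hs := Polynomial.prod_multiset_X_sub_C_of_monic_of_roots_card_eq hmonic (by
      rw [h, FiniteField.X_pow_card_sub_X_natDegree_eq _ hp.one_lt]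
      simp [ZMod.card])
    rw [h] at hs
    exact hs
  rcases eq_or_ne w 0 with rfl | hw
  · simp [zero_pow (Nat.sub_ne_zero_of_lt hp.one_lt), ZMod.card]
  · apply IsFractionRing.injective A (FractionRing A)
    set f := algebraMap A (FractionRing A) with hf
    have hw' : f w ≠ 0 := by simpa [hf] using hw
    have key := congrArg (Polynomial.eval₂ (f.comp (algebraMap (ZMod p) A)) (f z / f w)) hroots
    rw [Polynomial.eval₂_finsetProd] at key
    simp only [Polynomial.eval₂_sub, Polynomial.eval₂_X, Polynomial.eval₂_C,
      Polynomial.eval₂_pow] at key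
    rw [← Equiv.prod_comp (Equiv.neg (ZMod p))] at key
    simp only [Equiv.neg_apply, map_neg, sub_neg_eq_add] at key
    have key2 := congrArg (fun x => f w ^ p * x) key
    have hcard : f w ^ p = ∏ _a : ZMod p, f w := by simp [ZMod.card]
    conv_lhs at key2 => rw [hcard, ← Finset.prod_mul_distrib]
    have hpow : f w ^ p = f w ^ (p - 1) * f w := by
      rw [← pow_succ, Nat.sub_add_cancel hp.one_le]
    rw [map_prod]
    calc _ = ∏ a : ZMod p, f w * (f z / f w + (f.comp (algebraMap (ZMod p) A)) a) := by
          refine Finset.prod_congr rfl fun a _ => ?_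
          simp only [map_add, map_mul, RingHom.comp_apply]
          field_simp
      _ = _ := by
          rw [key2, mul_sub, ← mul_pow, mul_div_cancel₀ _ hw', hpow, mul_assoc,
            mul_div_cancel₀ _ hw']
          simp

/-- The product of all the translates `X + v·y` is an additive polynomial, i.e. only powers of
`X` with exponent a power of `p` occur in it. -/
theorem exists_prod_translates_eq_sum {p : ℕ} [Fact p.Prime] {A : Type*} [CommRing A] [IsDomain A]
    [Algebra (ZMod p) A] (n : ℕ) (y : Fin n → A) :
    ∃ c : ℕ → A, c n = 1 ∧ (∀ i, n < i → c i = 0) ∧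
      ∏ v : Fin n → ZMod p,
          (Polynomial.X + Polynomial.C (∑ j, algebraMap (ZMod p) A (v j) * y j)) =
        ∑ i ∈ Finset.range (n + 1), Polynomial.C (c i) * Polynomial.X ^ p ^ i := by
  have hp : p.Prime := Fact.out
  have : CharP A p := charP_of_injective_algebraMap (algebraMap (ZMod p) A).injective p
  induction n with
  | zero =>
    refine ⟨fun i => if i = 0 then 1 else 0, by simp, fun i hi => by simp [hi.ne'], by simp⟩
  | succ n ih =>
    obtain ⟨c, hc1, hc0, hc⟩ := ih (fun j => y j.succ)
    set f : Polynomial A := ∑ i ∈ Finset.range (n + 1), Polynomial.C (c i) * Polynomial.X ^ p ^ i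
      with hf
    set w : A := f.eval (y 0) with hw
    have hadd (a : ZMod p) :
        f.comp (Polynomial.X + Polynomial.C (algebraMap (ZMod p) A a * y 0)) =
          f + algebraMap (ZMod p) (Polynomial A) a * Polynomial.C w := by
      have ha (i : ℕ) : a ^ p ^ i = a := ZMod.pow_card_pow a
      have : algebraMap (ZMod p) (Polynomial A) a = Polynomial.C (algebraMap (ZMod p) A a) := rfl
      simp only [hw, hf, Polynomial.eval_finsetSum, Polynomial.sum_comp, Polynomial.mul_comp,
        Polynomial.C_comp, Polynomial.X_pow_comp, add_pow_char_pow, Polynomial.eval_mul,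
        Polynomial.eval_C, Polynomial.eval_pow, Polynomial.eval_X, mul_add, Finset.sum_add_distrib,
        map_sum, Finset.mul_sum, this, ← map_pow, mul_pow, ha, map_mul]
      exact congrArg _ (Finset.sum_congr rfl fun i _ => mul_left_comm _ _ _)
    refine ⟨fun i => (if i = 0 then 0 else c (i - 1) ^ p) - w ^ (p - 1) * c i, ?_, ?_, ?_⟩
    · simp [hc1, hc0]
    · intro i hi
      simp [hc0 i (by omega), hc0 (i - 1) (by omega), hp.ne_zero]
    · calc _ = ∏ a : ZMod p, ∏ v : Fin n → ZMod p, (Polynomial.X + Polynomial.C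
              (algebraMap (ZMod p) A a * y 0 +
                ∑ j, algebraMap (ZMod p) A (v j) * y j.succ)) := by
            rw [← Finset.prod_product', ← (Fin.consEquiv fun _ => ZMod p).prod_comp]
            refine Finset.prod_congr rfl fun v _ => ?_
            simp [Fin.sum_univ_succ, Fin.consEquiv]
        _ = ∏ a : ZMod p, f.comp (Polynomial.X +
              Polynomial.C (algebraMap (ZMod p) A a * y 0)) := by
            refine Finset.prod_congr rfl fun a _ => ?_
            rw [← hc, Polynomial.prod_comp]
            refine Finset.prod_congr rfl fun v _ => ?_
            simp [add_assoc]
        _ = f ^ p - Polynomial.C w ^ (p - 1) * f := by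
            rw [← prod_add_algebraMap_mul]
            exact Finset.prod_congr rfl fun a _ => hadd a
        _ = _ := by
            have h1 : f ^ p = ∑ i ∈ Finset.range (n + 1 + 1),
                Polynomial.C (if i = 0 then 0 else c (i - 1) ^ p) * Polynomial.X ^ p ^ i := by
              rw [Finset.sum_range_succ', hf, sum_pow_char]
              simp [mul_pow, ← pow_mul, ← pow_succ]
            have h2 : f = ∑ i ∈ Finset.range (n + 1 + 1),
                Polynomial.C (c i) * Polynomial.X ^ p ^ i := by
              rw [Finset.sum_range_succ, hc0 (n + 1) (by omega)]
              simp [hf]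
            rw [h1]
            nth_rw 1 [h2]
            rw [Finset.mul_sum, ← Finset.sum_sub_distrib]
            refine Finset.sum_congr rfl fun i _ => ?_
            simp only [map_sub, map_mul, map_pow]
            ring

theorem coeff_sum_C_mul_X_pow_pow {p n : ℕ} (hp : 1 < p) {A : Type*} [CommRing A] (b : ℕ → A)
    {i : ℕ} (hi : i ≤ n) :
    (∑ j ∈ Finset.range (n + 1), Polynomial.C (b j) * Polynomial.X ^ p ^ j).coeff (p ^ i) =
      b i := by
  rw [Polynomial.finsetSum_coeff, Finset.sum_eq_single i]
  · simp
  · intro j _ hj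
    rw [Polynomial.coeff_C_mul_X_pow, if_neg fun h => hj (Nat.pow_right_injective hp h).symm]
  · intro h
    simp only [Finset.mem_range] at h
    omega

/-- If `∏ (X + w_v) = ∑ c_i X^{p^i}` and `P(w_v) = w_v + w_v^p t` for a ring homomorphism `P`, then
the values of `P` on the coefficients `c_i` obey a recursion with multiplier `P(c_0) / c_0`. -/
theorem exists_total_operation_recursion {p n : ℕ} [Fact p.Prime] {R : Type*} [CommRing R]
    [Nontrivial R] [CharP R p] (P : R →+* Polynomial R) {ι : Type*} [Fintype ι]
    (hι : Fintype.card ι = p ^ n) (w : ι → R)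
    (hP : ∀ v, P (w v) = Polynomial.C (w v) + Polynomial.C (w v ^ p) * Polynomial.X)
    (c : ℕ → R) (hc1 : c n = 1)
    (hc : ∏ v, (Polynomial.X + Polynomial.C (w v)) =
      ∑ i ∈ Finset.range (n + 1), Polynomial.C (c i) * Polynomial.X ^ p ^ i) :
    ∃ B : Polynomial R, P (c 0) = B * Polynomial.C (c 0) ∧
      ∀ i < n, P (c (i + 1)) + Polynomial.X ^ p ^ i * P (c i)
          - Polynomial.X ^ p ^ n * Polynomial.C (c i) ^ p = B * Polynomial.C (c (i + 1)) := by
  have hp : p.Prime := Fact.out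
  obtain ⟨t, ht⟩ : ∃ t : Polynomial R, t = Polynomial.X := ⟨_, rfl⟩
  simp only [← ht]
  set f := ∏ v, (Polynomial.X + Polynomial.C (w v)) with hf
  set F := f.map Polynomial.C with hF
  have hFprod : F = ∏ v, (Polynomial.X + Polynomial.C (Polynomial.C (w v))) := by
    rw [hF, hf, Polynomial.map_prod]
    simp only [Polynomial.map_add, Polynomial.map_X, Polynomial.map_C]
  have hFmonic : F.Monic := by
    rw [hFprod]
    exact Polynomial.monic_prod_of_monic _ _ fun v _ => Polynomial.monic_X_add_C _
  have hFdeg : F.natDegree = p ^ n := by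
    rw [hFprod, Polynomial.natDegree_prod_of_monic _ _ fun v _ => Polynomial.monic_X_add_C _]
    simp only [Polynomial.natDegree_X_add_C]
    simp [hι]
  have hFsum : F = ∑ i ∈ Finset.range (n + 1),
      Polynomial.C (Polynomial.C (c i)) * Polynomial.X ^ p ^ i := by
    rw [hF, hc, Polynomial.map_sum]
    simp only [Polynomial.map_mul, Polynomial.map_pow, Polynomial.map_X, Polynomial.map_C]
  set H := f.eval₂ (Polynomial.C.comp P) (Polynomial.X + Polynomial.C t * Polynomial.X ^ p) with hH
  have hdvd : F ∣ H := by
    rw [hFprod, hH, hf, Polynomial.eval₂_finsetProd]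
    refine Finset.prod_dvd_prod_of_dvd _ _ fun v _ => ?_
    refine ⟨1 + Polynomial.C t *
      (Polynomial.X + Polynomial.C (Polynomial.C (w v))) ^ (p - 1), ?_⟩
    rw [mul_add, mul_one, mul_left_comm, mul_pow_sub_one hp.ne_zero, add_pow_char,
      Polynomial.eval₂_add, Polynomial.eval₂_X, Polynomial.eval₂_C]
    simp only [RingHom.comp_apply, hP, map_add, map_mul, map_pow, ht]
    ring
  obtain ⟨b, hb0, hb⟩ : ∃ b : ℕ → Polynomial R, b 0 = P (c 0) ∧ ∀ i, b (i + 1) =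
      P (c (i + 1)) + t ^ p ^ i * P (c i) - t ^ p ^ n * Polynomial.C (c i) ^ p :=
    ⟨fun i => Nat.casesOn i (P (c 0)) fun i =>
      P (c (i + 1)) + t ^ p ^ i * P (c i) - t ^ p ^ n * Polynomial.C (c i) ^ p, rfl, fun _ => rfl⟩
  have hsum : H - Polynomial.C (t ^ p ^ n) * F ^ p =
      ∑ i ∈ Finset.range (n + 1), Polynomial.C (b i) * Polynomial.X ^ p ^ i := by
    have h1 : H = ∑ i ∈ Finset.range (n + 1), Polynomial.C (P (c i)) * Polynomial.X ^ p ^ i +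
        ∑ i ∈ Finset.range (n + 1),
          Polynomial.C (t ^ p ^ i * P (c i)) * Polynomial.X ^ p ^ (i + 1) := by
      rw [hH, hc, Polynomial.eval₂_finsetSum, ← Finset.sum_add_distrib]
      refine Finset.sum_congr rfl fun i _ => ?_
      rw [Polynomial.eval₂_mul, Polynomial.eval₂_C, Polynomial.eval₂_X_pow, add_pow_char_pow]
      simp only [RingHom.comp_apply, map_mul, map_pow]
      ring
    have h2 : F ^ p = ∑ i ∈ Finset.range (n + 1),
        Polynomial.C (Polynomial.C (c i) ^ p) * Polynomial.X ^ p ^ (i + 1) := by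
      rw [hFsum, sum_pow_char]
      refine Finset.sum_congr rfl fun i _ => ?_
      rw [mul_pow, ← pow_mul, ← pow_succ, map_pow]
    have h3 : ∑ i ∈ Finset.range n, Polynomial.C (b (i + 1)) * Polynomial.X ^ p ^ (i + 1) =
        ∑ i ∈ Finset.range n, Polynomial.C (P (c (i + 1))) * Polynomial.X ^ p ^ (i + 1) +
        ∑ i ∈ Finset.range n,
          Polynomial.C (t ^ p ^ i * P (c i)) * Polynomial.X ^ p ^ (i + 1) -
        Polynomial.C (t ^ p ^ n) * ∑ i ∈ Finset.range n,
          Polynomial.C (Polynomial.C (c i) ^ p) * Polynomial.X ^ p ^ (i + 1) := by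
      rw [Finset.mul_sum, ← Finset.sum_add_distrib, ← Finset.sum_sub_distrib]
      refine Finset.sum_congr rfl fun i _ => ?_
      simp only [hb, map_add, map_sub, map_mul]
      ring
    rw [h1, h2, Finset.sum_range_succ' _ n, Finset.sum_range_succ _ n, Finset.sum_range_succ _ n,
      Finset.sum_range_succ' _ n, hc1, h3, hb0]
    simp only [map_one, one_pow, mul_one]
    ring
  obtain ⟨q, hq⟩ : F ∣ H - Polynomial.C (t ^ p ^ n) * F ^ p :=
    dvd_sub hdvd ((dvd_pow_self F hp.ne_zero).mul_left _)
  have hdeg : (F * q).natDegree ≤ p ^ n := by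
    rw [← hq, hsum]
    refine Polynomial.natDegree_sum_le_of_forall_le _ _ fun i hi => ?_
    refine (Polynomial.natDegree_C_mul_X_pow_le _ _).trans ?_
    exact Nat.pow_le_pow_right hp.pos (Finset.mem_range_succ_iff.mp hi)
  have hq0 : q.natDegree = 0 := by
    rcases eq_or_ne q 0 with rfl | h0
    · simp
    · rw [hFmonic.natDegree_mul' h0, hFdeg] at hdeg
      omega
  rw [Polynomial.eq_C_of_natDegree_eq_zero hq0] at hq
  have hcomp (i : ℕ) (hi : i ≤ n) : b i = q.coeff 0 * Polynomial.C (c i) := by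
    rw [← coeff_sum_C_mul_X_pow_pow hp.one_lt b hi, ← hsum, hq, mul_comm, Polynomial.coeff_C_mul,
      hFsum, coeff_sum_C_mul_X_pow_pow hp.one_lt (fun i => Polynomial.C (c i)) hi]
  exact ⟨q.coeff 0, hb0 ▸ hcomp 0 (Nat.zero_le _), fun i hi => hb i ▸ hcomp (i + 1) hi⟩

theorem Pt_linearForm {p n : ℕ} [Fact p.Prime] (v : Fin n → ZMod p) :
    Pt p n (∑ j, C (v j) * X j) =
      Polynomial.C (∑ j, C (v j) * X j) +
        Polynomial.C ((∑ j, C (v j) * X j) ^ p) * Polynomial.X := by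
  have hC (a : ZMod p) : Pt p n (C a) = Polynomial.C (C a) := (Pt p n).commutes a
  have hX (j : Fin n) : Pt p n (X j) =
      Polynomial.C (X j) + Polynomial.C (X j ^ p) * Polynomial.X := by simp [Pt]
  have hpow (a : ZMod p) : (C a : MvPolynomial (Fin n) (ZMod p)) ^ p = C a := by
    rw [← map_pow, ZMod.pow_card]
  rw [sum_pow_char]
  simp only [map_sum, map_mul, hC, hX, mul_pow, hpow, Finset.sum_mul, ← Finset.sum_add_distrib]
  exact Finset.sum_congr rfl fun j _ => by ring

/-- The Dickson invariants are, up to sign, the coefficients `c i` of the additive polynomial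
`∏ (X + v·y) = ∑ c_i X^{p^i}`, and the total Steenrod operation on them obeys a recursion with
multiplier `P_t(c_0) / c_0`. -/
theorem exists_Pt_recursion (p n : ℕ) [Fact p.Prime] :
    ∃ (c : ℕ → MvPolynomial (Fin n) (ZMod p)) (B : Polynomial (MvPolynomial (Fin n) (ZMod p))),
      c n = 1 ∧ (∀ i ≤ n, dickson p n i = (-1) ^ i * c (n - i)) ∧
      Pt p n (c 0) = B * Polynomial.C (c 0) ∧
      ∀ i < n, Pt p n (c (i + 1)) + Polynomial.X ^ p ^ i * Pt p n (c i)
          - Polynomial.X ^ p ^ n * Polynomial.C (c i) ^ p = B * Polynomial.C (c (i + 1)) := by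
  have hp : p.Prime := Fact.out
  obtain ⟨c, hc1, -, hc⟩ := exists_prod_translates_eq_sum (p := p) n
    (X : Fin n → MvPolynomial (Fin n) (ZMod p))
  rw [MvPolynomial.algebraMap_eq] at hc
  obtain ⟨B, h0, hB⟩ := exists_total_operation_recursion (Pt p n : _ →+* _) (by simp [ZMod.card])
    (fun v : Fin n → ZMod p => ∑ j, C (v j) * X j) Pt_linearForm c hc1 hc
  refine ⟨c, B, hc1, fun i hi => ?_, h0, hB⟩
  rw [dickson, hc, coeff_sum_C_mul_X_pow_pow hp.one_lt c (Nat.sub_le _ _)]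

theorem coeff_zero_Pt {p n : ℕ} [Fact p.Prime] (F : MvPolynomial (Fin n) (ZMod p)) :
    (Pt p n F).coeff 0 = F := by
  have h : ((Polynomial.aeval (0 : MvPolynomial (Fin n) (ZMod p))).restrictScalars (ZMod p)).comp
      (Pt p n) = AlgHom.id (ZMod p) _ := by
    ext i
    simp [Pt]
  rw [Polynomial.coeff_zero_eq_aeval_zero]
  simpa using DFunLike.congr_fun h F

/-- `P_t` fixes `F` modulo `t^e`. -/
def PtFixedMod (p n e : ℕ) (F : MvPolynomial (Fin n) (ZMod p)) : Prop :=
  Polynomial.X ^ e ∣ Pt p n F - Polynomial.C F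

/-- `P_t(F) ≡ F + G t^e` modulo `t^{e+1}`. -/
def PtLead (p n e : ℕ) (F G : MvPolynomial (Fin n) (ZMod p)) : Prop :=
  Polynomial.X ^ (e + 1) ∣ Pt p n F - Polynomial.C F - Polynomial.C G * Polynomial.X ^ e

section

variable {p n e e' : ℕ} {F F' G G' : MvPolynomial (Fin n) (ZMod p)}

theorem PtFixedMod.mono (h : PtFixedMod p n e F) (he : e' ≤ e) : PtFixedMod p n e' F :=
  (pow_dvd_pow _ he).trans h

theorem PtFixedMod.lead_zero (h : PtFixedMod p n e F) (he : e' < e) : PtLead p n e' F 0 := by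
  simpa [PtLead, PtFixedMod] using h.mono he

theorem PtFixedMod.mul (h : PtFixedMod p n e F) (h' : PtFixedMod p n e F') :
    PtFixedMod p n e (F * F') := by
  obtain ⟨a, ha⟩ := h
  obtain ⟨b, hb⟩ := h'
  refine ⟨a * Pt p n F' + Polynomial.C F * b, ?_⟩
  rw [map_mul, map_mul]
  linear_combination Pt p n F' * ha + Polynomial.C F * hb

theorem PtFixedMod.one : PtFixedMod p n e 1 := by
  simp [PtFixedMod]

theorem PtFixedMod.pow (h : PtFixedMod p n e F) (k : ℕ) : PtFixedMod p n e (F ^ k) := by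
  induction k with
  | zero => simpa using PtFixedMod.one
  | succ k ih => simpa only [pow_succ] using ih.mul h

theorem PtFixedMod.prod {ι : Type*} (s : Finset ι) (f : ι → MvPolynomial (Fin n) (ZMod p))
    (h : ∀ i ∈ s, PtFixedMod p n e (f i)) : PtFixedMod p n e (∏ i ∈ s, f i) :=
  Finset.prod_induction f _ (fun _ _ => PtFixedMod.mul) PtFixedMod.one h

theorem PtFixedMod.pow_char_pow [Fact p.Prime] (h : PtFixedMod p n e F) (v : ℕ) :
    PtFixedMod p n (e * p ^ v) (F ^ p ^ v) := by
  have := pow_dvd_pow_of_dvd h (p ^ v)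
  rwa [sub_pow_char_pow, ← pow_mul, ← map_pow, ← map_pow] at this

theorem ptFixedMod_one [Fact p.Prime] (F : MvPolynomial (Fin n) (ZMod p)) :
    PtFixedMod p n 1 F := by
  rw [PtFixedMod, pow_one, Polynomial.X_dvd_iff]
  simp [coeff_zero_Pt]

theorem PtLead.fixedMod (h : PtLead p n e F G) : PtFixedMod p n e F := by
  have h1 := (pow_dvd_pow Polynomial.X e.le_succ).trans h
  simpa [PtFixedMod] using dvd_add h1 (dvd_mul_left (Polynomial.X ^ e) (Polynomial.C G))

theorem PtLead.steenrod (he : 0 < e) (h : PtLead p n e F G) : steenrod p n e F = G := by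
  have := Polynomial.X_pow_dvd_iff.mp h e e.lt_succ_self
  rw [Polynomial.coeff_sub, Polynomial.coeff_sub, Polynomial.coeff_C_mul_X_pow,
    Polynomial.coeff_C, if_neg he.ne', if_pos rfl, sub_zero] at this
  exact sub_eq_zero.mp this

theorem PtLead.mul (he : 0 < e) (h : PtLead p n e F G) (h' : PtLead p n e F' G') :
    PtLead p n e (F * F') (F * G' + F' * G) := by
  obtain ⟨a, ha⟩ := h
  obtain ⟨b, hb⟩ := h'
  obtain ⟨d, rfl⟩ : ∃ d, e = d + 1 := ⟨e - 1, by omega⟩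
  refine ⟨a * Pt p n F' + b * Polynomial.C F + Polynomial.C G * Polynomial.X ^ (d + 1) * b +
    Polynomial.C G * Polynomial.C G' * Polynomial.X ^ d, ?_⟩
  simp only [map_mul, map_add]
  linear_combination Pt p n F' * ha +
    (Polynomial.C F + Polynomial.C G * Polynomial.X ^ (d + 1)) * hb

theorem PtLead.pow (he : 0 < e) (h : PtLead p n e F G) (k : ℕ) :
    PtLead p n e (F ^ k) (k * (F ^ (k - 1) * G)) := by
  induction k with
  | zero => simpa using PtFixedMod.one.lead_zero e.lt_succ_self
  | succ k ih =>
    have := ih.mul he h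
    rw [← pow_succ] at this
    convert this using 1
    cases k with
    | zero => simp
    | succ k =>
      simp only [Nat.add_sub_cancel, Nat.cast_add, Nat.cast_one]
      ring

theorem PtLead.pow_char_pow [Fact p.Prime] (h : PtLead p n e F G) (v : ℕ) :
    PtLead p n (e * p ^ v) (F ^ p ^ v) (G ^ p ^ v) := by
  have hp : p.Prime := Fact.out
  have := pow_dvd_pow_of_dvd h (p ^ v)
  rw [sub_pow_char_pow, sub_pow_char_pow, mul_pow, ← pow_mul, ← pow_mul, ← map_pow, ← map_pow,
    ← map_pow] at this
  refine (pow_dvd_pow _ ?_).trans this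
  have := Nat.pow_pos (n := v) hp.pos
  nlinarith

theorem PtLead.prod {ι : Type*} [DecidableEq ι] (he : 0 < e) (s : Finset ι)
    (f g : ι → MvPolynomial (Fin n) (ZMod p)) (h : ∀ i ∈ s, PtLead p n e (f i) (g i)) :
    PtLead p n e (∏ i ∈ s, f i) (∑ i ∈ s, (∏ j ∈ s.erase i, f j) * g i) := by
  induction s using Finset.induction_on with
  | empty => simpa using PtFixedMod.one.lead_zero e.lt_succ_self
  | insert a s ha ih =>
    have := (h a (Finset.mem_insert_self _ _)).mul he
      (ih fun i hi => h i (Finset.mem_insert_of_mem hi))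
    rw [Finset.prod_insert ha, Finset.sum_insert ha, Finset.erase_insert ha]
    convert this using 1
    rw [add_comm, Finset.mul_sum]
    congr 1
    refine Finset.sum_congr rfl fun i hi => ?_
    have hai : a ≠ i := fun h => ha (h ▸ hi)
    rw [Finset.erase_insert_of_ne hai, Finset.prod_insert (by simp [ha]), mul_assoc]

end

theorem ptLead_dickson {p n l : ℕ} [Fact p.Prime] (hl : 1 ≤ l) (hln : l < n) :
    PtLead p n (p ^ (n - 1 - l)) (dickson p n l) (dickson p n (l + 1)) := by
  have hp : p.Prime := Fact.out
  obtain ⟨c, B, hc1, hd, -, hB⟩ := exists_Pt_recursion p n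
  obtain ⟨j, rfl⟩ : ∃ j, n = l + 1 + j := ⟨n - l - 1, by omega⟩
  have hlast := hB (l + j) (by omega)
  have hj := hB j (by omega)
  rw [show l + j + 1 = l + 1 + j by omega, hc1, map_one, map_one, mul_one] at hlast
  rw [hd l (by omega), hd (l + 1) (by omega), show l + 1 + j - l = j + 1 by omega,
    show l + 1 + j - (l + 1) = j by omega, show l + 1 + j - 1 - l = j by omega, PtLead]
  obtain ⟨z, hz⟩ : Polynomial.X ∣ Pt p (l + 1 + j) (c j) - Polynomial.C (c j) := by
    simpa [PtFixedMod] using ptFixedMod_one (c j)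
  obtain ⟨r, hr⟩ := Nat.exists_eq_add_of_lt (Nat.pow_lt_pow_right hp.one_lt
    (show j < l + j by omega))
  obtain ⟨s, hs⟩ := Nat.exists_eq_add_of_lt (Nat.pow_lt_pow_right hp.one_lt
    (show j < l + 1 + j by omega))
  rw [hs, hr] at hlast
  rw [hs] at hj
  refine ⟨(-1) ^ l * ((Polynomial.X ^ r * Pt p (l + 1 + j) (c (l + j)) -
    Polynomial.X ^ s * Polynomial.C (c (l + j)) ^ p) * Polynomial.C (c (j + 1)) - z +
    Polynomial.X ^ s * Polynomial.C (c j) ^ p), ?_⟩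
  simp only [map_mul, map_pow, map_neg, map_one]
  linear_combination (-1) ^ l * hj - (-1) ^ l * Polynomial.C (c (j + 1)) * hlast -
    (-1) ^ l * Polynomial.X ^ p ^ j * hz

theorem ptLead_dickson_top {p n : ℕ} [Fact p.Prime] (hn : 1 ≤ n) :
    PtLead p n (p ^ (n - 1)) (dickson p n n) (-(dickson p n n * dickson p n 1)) := by
  have hp : p.Prime := Fact.out
  obtain ⟨c, B, hc1, hd, h0, hB⟩ := exists_Pt_recursion p n
  obtain ⟨j, rfl⟩ : ∃ j, n = j + 1 := ⟨n - 1, by omega⟩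
  have hlast := hB j (by omega)
  rw [hc1, map_one, map_one, mul_one] at hlast
  rw [hd (j + 1) le_rfl, hd 1 hn, Nat.sub_self, Nat.add_sub_cancel, PtLead]
  obtain ⟨z, hz⟩ : Polynomial.X ∣ Pt p (j + 1) (c j) - Polynomial.C (c j) := by
    simpa [PtFixedMod] using ptFixedMod_one (c j)
  obtain ⟨s, hs⟩ := Nat.exists_eq_add_of_lt (Nat.pow_lt_pow_right hp.one_lt j.lt_succ_self)
  rw [Nat.succ_eq_add_one] at hs
  rw [hs] at hlast
  refine ⟨(-1) ^ (j + 1) * Polynomial.C (c 0) *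
    (z - Polynomial.X ^ s * Polynomial.C (c j) ^ p), ?_⟩
  simp only [map_mul, map_pow, map_neg, map_one]
  linear_combination (-1) ^ (j + 1) * h0 - (-1) ^ (j + 1) * Polynomial.C (c 0) * hlast +
    (-1) ^ (j + 1) * Polynomial.C (c 0) * Polynomial.X ^ p ^ j * hz

/-! ### Composites of Steenrod operations -/

section

variable {p n : ℕ}

theorem steenrod_add (k : ℕ) (F G : MvPolynomial (Fin n) (ZMod p)) :
    steenrod p n k (F + G) = steenrod p n k F + steenrod p n k G := by
  simp [steenrod]

theorem steenrod_smul (k : ℕ) (a : ZMod p) (F : MvPolynomial (Fin n) (ZMod p)) :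
    steenrod p n k (a • F) = a • steenrod p n k F := by
  simp [steenrod]

/-- The composite `P^{p^{s_1}} ∘ ⋯ ∘ P^{p^{s_r}}` as a linear map. -/
noncomputable def steenrodListLinear (p n : ℕ) (cs : List ℕ) :
    MvPolynomial (Fin n) (ZMod p) →ₗ[ZMod p] MvPolynomial (Fin n) (ZMod p) where
  toFun := steenrodList p n cs
  map_add' F G := by
    induction cs with
    | nil => rfl
    | cons s cs ih => simp only [steenrodList, ih, steenrod_add]
  map_smul' a F := by
    induction cs with
    | nil => rfl
    | cons s cs ih => simp only [steenrodList, ih, steenrod_smul, RingHom.id_apply]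

theorem steenrodListLinear_append (cs ds : List ℕ) (F : MvPolynomial (Fin n) (ZMod p)) :
    steenrodListLinear p n (cs ++ ds) F =
      steenrodListLinear p n cs (steenrodListLinear p n ds F) := by
  induction cs with
  | nil => rfl
  | cons s cs ih => exact congrArg (steenrod p n (p ^ s)) ih

variable [Fact p.Prime]

theorem PtLead.steenrodListLinear {s : ℕ} {F G : MvPolynomial (Fin n) (ZMod p)}
    (h : PtLead p n (p ^ s) F G) : steenrodListLinear p n [s] F = G :=
  h.steenrod (Nat.pow_pos (Fact.out : p.Prime).pos)

/-- The operations `P^{p^{v+r-1}}, …, P^{p^v}` successively replace a factor `d_{n-r}^{p^v}` by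
`d_{n-r+1}^{p^v}, …, d_n^{p^v}`. -/
theorem steenrodListLinear_range'_dickson_pow {v r : ℕ} (hr : r < n)
    {W : MvPolynomial (Fin n) (ZMod p)} (hW : PtFixedMod p n (p ^ (v + r)) W) :
    steenrodListLinear p n (List.range' v r) (W * dickson p n (n - r) ^ p ^ v) =
      W * dickson p n n ^ p ^ v := by
  have hp : p.Prime := Fact.out
  induction r with
  | zero => rfl
  | succ r ih =>
    have hlead := ptLead_dickson (p := p) (n := n) (l := n - (r + 1)) (by omega) (by omega)
    rw [show n - 1 - (n - (r + 1)) = r by omega, show n - (r + 1) + 1 = n - r by omega] at hlead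
    have hlead := hlead.pow_char_pow v
    rw [← pow_add, add_comm r v] at hlead
    have hlt := Nat.pow_lt_pow_right hp.one_lt (show v + r < v + (r + 1) by omega)
    have := (hW.lead_zero hlt).mul (Nat.pow_pos hp.pos) hlead
    rw [mul_zero, add_zero] at this
    rw [List.range'_1_concat, steenrodListLinear_append, this.steenrodListLinear]
    exact ih (by omega) (hW.mono hlt.le)

/-- If the factor `d_{n-r}^{p^{v+s+1}}` is already exhausted after `r` operations, the remaining
operations annihilate the product. -/
theorem steenrodListLinear_range'_dickson_pow_eq_zero {v r s : ℕ} (hr : r < n)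
    {W : MvPolynomial (Fin n) (ZMod p)} (hW : PtFixedMod p n (p ^ (v + (s + 1) + r)) W) :
    steenrodListLinear p n (List.range' v (s + 1 + r))
      (W * dickson p n (n - r) ^ p ^ (v + (s + 1))) = 0 := by
  have hp : p.Prime := Fact.out
  have hfix : PtFixedMod p n (p ^ (v + (s + 1))) (W * dickson p n n ^ p ^ (v + (s + 1))) := by
    refine (hW.mono (Nat.pow_le_pow_right hp.pos (by omega))).mul ?_
    simpa using (ptFixedMod_one (dickson p n n)).pow_char_pow (v + (s + 1))
  rw [← List.range'_append_1, steenrodListLinear_append,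
    steenrodListLinear_range'_dickson_pow hr hW, List.range'_1_concat, steenrodListLinear_append,
    (hfix.lead_zero (Nat.pow_lt_pow_right hp.one_lt (by omega))).steenrodListLinear, map_zero]

end

/-! ### Steps between monomials -/

/-- The exponent `r` such that `P^{p^r}` is the first `P^{p^c}` acting nontrivially on
`d_{n,l}`. -/
def dicksonLag (n l : ℕ) : ℕ := if l = n then n - 1 else n - 1 - l

theorem dicksonLag_lt {n l : ℕ} (hl : l ∈ Finset.Icc 1 n) : dicksonLag n l < n := by
  rw [Finset.mem_Icc] at hl
  unfold dicksonLag
  split_ifs <;> omega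

theorem dicksonLag_injOn {n : ℕ} : Set.InjOn (dicksonLag n) (Finset.Icc 1 n) := by
  intro i hi j hj h
  simp only [Finset.coe_Icc, Set.mem_Icc] at hi hj
  unfold dicksonLag at h
  split_ifs at h <;> omega

/-- The exponents obtained from `K` by lowering `K l` (if `l ≠ n`) and raising `K n` by the
`p`-part of `K l`. -/
def moveToTop (p n l : ℕ) (K : ℕ → ℕ) (j : ℕ) : ℕ :=
  if j = n then K n + p ^ padicValNat p (K l)
  else if j = l then K l - p ^ padicValNat p (K l) else K j

section

variable {p n : ℕ} [Fact p.Prime]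

theorem exists_ptLead_dickson_pow {l k : ℕ} (hl : l ∈ Finset.Icc 1 n) (hk : k ≠ 0) :
    ∃ (u : (ZMod p)ˣ) (W : MvPolynomial (Fin n) (ZMod p)),
      W = (if l = n then dickson p n n ^ k else dickson p n l ^ (k - p ^ padicValNat p k)) ∧
      PtFixedMod p n (p ^ (padicValNat p k + dicksonLag n l)) W ∧
      PtLead p n (p ^ (padicValNat p k + dicksonLag n l)) (dickson p n l ^ k)
        ((u : ZMod p) • (W * dickson p n (n - dicksonLag n l) ^ p ^ padicValNat p k)) := by
  have hp : p.Prime := Fact.out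
  set v := padicValNat p k with hv
  obtain ⟨m, hm⟩ : p ^ v ∣ k := pow_padicValNat_dvd
  have hpm : ¬ p ∣ m := by
    rintro ⟨q, rfl⟩
    refine pow_succ_padicValNat_not_dvd hk (?_ : p ^ (v + 1) ∣ k)
    exact ⟨q, by rw [hm, pow_succ, mul_assoc]⟩
  have hm0 : (m : ZMod p) ≠ 0 := by rwa [Ne, ZMod.natCast_eq_zero_iff]
  rw [Finset.mem_Icc] at hl
  obtain ⟨s, b, hb, hfix, hlead⟩ : ∃ (s : (ZMod p)ˣ) (b : MvPolynomial (Fin n) (ZMod p)),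
      b = (if l = n then dickson p n n else 1) ∧ PtFixedMod p n (p ^ dicksonLag n l) b ∧
      PtLead p n (p ^ dicksonLag n l) (dickson p n l)
        (C (s : ZMod p) * (b * dickson p n (n - dicksonLag n l))) := by
    unfold dicksonLag
    by_cases hln : l = n
    · subst hln
      have hlead := ptLead_dickson_top (p := p) hl.1
      refine ⟨-1, dickson p l l, by simp, by simpa using hlead.fixedMod, ?_⟩
      simpa [show l - (l - 1) = 1 by omega] using hlead
    · have hlead := ptLead_dickson (p := p) hl.1 (lt_of_le_of_ne hl.2 hln)
      refine ⟨1, 1, by simp [hln], PtFixedMod.one, ?_⟩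
      simpa [hln, show n - (n - 1 - l) = l + 1 by omega] using hlead
  have hlead' := (hlead.pow (Nat.pow_pos hp.pos) m).pow_char_pow v
  have hfix' := ((hlead.fixedMod.pow (m - 1)).mul hfix).pow_char_pow v
  rw [← pow_add, add_comm] at hlead' hfix'
  refine ⟨(Units.mk0 _ hm0 * s) ^ p ^ v, (dickson p n l ^ (m - 1) * b) ^ p ^ v, ?_, hfix', ?_⟩
  · have hm1 : m = m - 1 + 1 := by
      have : m ≠ 0 := fun h => hpm (h ▸ dvd_zero p)
      omega
    split_ifs with hln
    · rw [hb, if_pos hln, hln, ← pow_succ, ← hm1, ← pow_mul, hm, mul_comm]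
    · rw [hb, if_neg hln, mul_one, ← pow_mul, Nat.sub_mul, one_mul]
      conv_rhs => rw [hm, mul_comm]
  · rw [← pow_mul, mul_comm m, ← hm] at hlead'
    convert hlead' using 1
    rw [MvPolynomial.smul_eq_C_mul, Units.val_pow_eq_pow_val, Units.val_mul, Units.val_mk0,
      map_pow, map_mul, map_natCast]
    ring

theorem prod_dickson_moveToTop {l : ℕ} (hl : l ∈ Finset.Icc 1 n) (K : ℕ → ℕ) :
    (∏ j ∈ (Finset.Icc 1 n).erase l, dickson p n j ^ K j) *
        (if l = n then dickson p n n ^ K l else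
          dickson p n l ^ (K l - p ^ padicValNat p (K l))) *
        dickson p n n ^ p ^ padicValNat p (K l) =
      ∏ j ∈ Finset.Icc 1 n, dickson p n j ^ moveToTop p n l K j := by
  rw [← Finset.mul_prod_erase _ _ hl]
  by_cases hln : l = n
  · subst hln
    have : ∏ j ∈ (Finset.Icc 1 l).erase l, dickson p l j ^ moveToTop p l l K j =
        ∏ j ∈ (Finset.Icc 1 l).erase l, dickson p l j ^ K j :=
      Finset.prod_congr rfl fun j hj => by
        simp [moveToTop, Finset.ne_of_mem_erase hj]
    rw [this, moveToTop, if_pos rfl, if_pos rfl, pow_add]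
    ring
  · have hn : n ∈ (Finset.Icc 1 n).erase l := by
      rw [Finset.mem_Icc] at hl
      simp only [Finset.mem_erase, Finset.mem_Icc]
      omega
    have : ∏ j ∈ ((Finset.Icc 1 n).erase l).erase n, dickson p n j ^ moveToTop p n l K j =
        ∏ j ∈ ((Finset.Icc 1 n).erase l).erase n, dickson p n j ^ K j :=
      Finset.prod_congr rfl fun j hj => by
        simp only [Finset.mem_erase] at hj
        simp [moveToTop, hj.1, hj.2.1]
    rw [← Finset.mul_prod_erase _ _ hn, ← Finset.mul_prod_erase _ _ hn, this]
    simp only [moveToTop, if_neg hln, if_pos, pow_add]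
    ring

theorem exists_steenrod_moveToTop (K : ℕ → ℕ) (hK : ∃ i ∈ Finset.Icc 1 n, K i ≠ 0) :
    ∃ l ∈ Finset.Icc 1 n, K l ≠ 0 ∧
      (∀ j ∈ Finset.Icc 1 n, K j ≠ 0 →
        padicValNat p (K l) + dicksonLag n l ≤ padicValNat p (K j) + dicksonLag n j) ∧
      ∃ (cs : List ℕ) (u : (ZMod p)ˣ),
        steenrodListLinear p n cs (∏ j ∈ Finset.Icc 1 n, dickson p n j ^ K j) =
          (u : ZMod p) • ∏ j ∈ Finset.Icc 1 n, dickson p n j ^ moveToTop p n l K j := by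
  have hp : p.Prime := Fact.out
  obtain ⟨l, hlS, hmin⟩ := Finset.exists_min_image ((Finset.Icc 1 n).filter fun i => K i ≠ 0)
    (fun i => toLex (padicValNat p (K i) + dicksonLag n i, OrderDual.toDual (dicksonLag n i)))
    (by obtain ⟨i, hi, h⟩ := hK; exact ⟨i, Finset.mem_filter.mpr ⟨hi, h⟩⟩)
  obtain ⟨hl, hl0⟩ := Finset.mem_filter.mp hlS
  have hmin' (j : ℕ) (hj : j ∈ Finset.Icc 1 n) (hj0 : K j ≠ 0) :
      padicValNat p (K l) + dicksonLag n l < padicValNat p (K j) + dicksonLag n j ∨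
      padicValNat p (K l) + dicksonLag n l = padicValNat p (K j) + dicksonLag n j ∧
        dicksonLag n j ≤ dicksonLag n l := by
    have := hmin j (Finset.mem_filter.mpr ⟨hj, hj0⟩)
    rwa [Prod.Lex.toLex_le_toLex] at this
  obtain ⟨u, W, hW, hWfix, hWlead⟩ := exists_ptLead_dickson_pow (p := p) hl hl0
  set v := padicValNat p (K l) with hv
  set r := dicksonLag n l
  have hfix (j : ℕ) (hj : j ∈ Finset.Icc 1 n) :
      PtFixedMod p n (p ^ (v + r)) (dickson p n j ^ K j) := by
    by_cases hj0 : K j = 0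
    · rw [hj0, pow_zero]
      exact PtFixedMod.one
    · obtain ⟨_, _, -, -, h⟩ := exists_ptLead_dickson_pow (p := p) hj hj0
      refine h.fixedMod.mono (Nat.pow_le_pow_right hp.pos ?_)
      rcases hmin' j hj hj0 with h | h <;> omega
  have hG (j : ℕ) (hj : j ∈ Finset.Icc 1 n) : ∃ G : MvPolynomial (Fin n) (ZMod p),
      PtLead p n (p ^ (v + r)) (dickson p n j ^ K j) G ∧
      ∀ M, PtFixedMod p n (p ^ (v + r)) M → steenrodListLinear p n (List.range' v r) (M * G) =
        if j = l then (u : ZMod p) • (M * W * dickson p n n ^ p ^ v) else 0 := by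
    by_cases hjl : j = l
    · subst hjl
      refine ⟨_, hWlead, fun M hM => ?_⟩
      rw [mul_smul_comm, map_smul, ← mul_assoc,
        steenrodListLinear_range'_dickson_pow (dicksonLag_lt hl) (hM.mul hWfix), if_pos rfl]
    · simp only [if_neg hjl]
      by_cases hj0 : K j = 0
      · refine ⟨0, ?_, fun M hM => by simp⟩
        rw [hj0, pow_zero]
        exact PtFixedMod.one.lead_zero (Nat.lt_succ_self _)
      · obtain ⟨u', W', -, hfix', hlead'⟩ := exists_ptLead_dickson_pow (p := p) hj hj0
        rcases hmin' j hj hj0 with h | ⟨h, hle⟩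
        · refine ⟨0, hlead'.fixedMod.lead_zero (Nat.pow_lt_pow_right hp.one_lt h),
            fun M hM => by simp⟩
        · have hlt : dicksonLag n j < r :=
            lt_of_le_of_ne hle fun h => hjl (dicksonLag_injOn hj hl h)
          obtain ⟨s, hs⟩ : ∃ s, r = s + 1 + dicksonLag n j :=
            ⟨r - 1 - dicksonLag n j, by omega⟩
          have hvs : padicValNat p (K j) = v + (s + 1) := by omega
          have hvr : v + r = v + (s + 1) + dicksonLag n j := by omega
          rw [hvs, ← hvr] at hlead' hfix'
          refine ⟨_, hlead', fun M hM => ?_⟩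
          have hMW := hM.mul hfix'
          rw [hvr] at hMW
          rw [mul_smul_comm, map_smul, ← mul_assoc, hs,
            steenrodListLinear_range'_dickson_pow_eq_zero (dicksonLag_lt hj) hMW, smul_zero]
  choose! G hGlead hGval using hG
  have hprod := PtLead.prod (Nat.pow_pos hp.pos) (Finset.Icc 1 n) _ G hGlead
  refine ⟨l, hl, hl0, fun j hj hj0 => ?_, List.range' v r ++ [v + r], u, ?_⟩
  · rcases hmin' j hj hj0 with h | h <;> omega
  · rw [steenrodListLinear_append, hprod.steenrodListLinear, map_sum, Finset.sum_eq_single l]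
    · rw [hGval l hl _ (PtFixedMod.prod _ _ fun j hj => hfix j (Finset.mem_of_mem_erase hj)),
        if_pos rfl, hW, prod_dickson_moveToTop hl]
    · intro j hj hjl
      rw [hGval j hj _ (PtFixedMod.prod _ _ fun i hi => hfix i (Finset.mem_of_mem_erase hi)),
        if_neg hjl]
    · exact fun h => absurd hl h

/-- Iterating the step `K ↦ moveToTop p n l K` ends in a `p`-th power of `d_{n,n}`. -/
theorem exists_steenrodListLinear_prod_dickson (K : ℕ → ℕ)
    (hK : ∃ i ∈ Finset.Icc 1 n, K i ≠ 0) :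
    ∃ (cs : List ℕ) (m : ℕ) (u : (ZMod p)ˣ),
      steenrodListLinear p n cs (∏ i ∈ Finset.Icc 1 n, dickson p n i ^ K i) =
        (u : ZMod p) • dickson p n n ^ p ^ m := by
  have hp : p.Prime := Fact.out
  have hn : n ∈ Finset.Icc 1 n := by
    obtain ⟨i, hi, -⟩ := hK
    rw [Finset.mem_Icc] at hi ⊢
    omega
  induction hS : ∑ j ∈ Finset.Ico 1 n, K j using Nat.strong_induction_on generalizing K with
  | _ S ihS =>
    obtain ⟨L, hL⟩ : ∃ L, ∀ j ∈ Finset.Icc 1 n, K j < p ^ L := by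
      refine ⟨∑ j ∈ Finset.Icc 1 n, K j, fun j hj => ?_⟩
      exact (Finset.single_le_sum (fun _ _ => Nat.zero_le _) hj).trans_lt
        (Nat.lt_pow_self hp.one_lt)
    have hLlow : ∀ j ∈ Finset.Ico 1 n, K j < p ^ L := fun j hj =>
      hL j (Finset.Ico_subset_Icc_self hj)
    obtain ⟨d, hd⟩ := Nat.exists_eq_add_of_le (hL n hn).le
    clear hL
    induction d using Nat.strong_induction_on generalizing K with
    | _ d ihd =>
      obtain ⟨l, hl, hl0, hmin, cs, u, hcs⟩ := exists_steenrod_moveToTop (p := p) K hK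
      set v := padicValNat p (K l) with hv
      have hdvd : p ^ v ∣ K l := pow_padicValNat_dvd
      have hpos : 0 < p ^ v := Nat.pow_pos hp.pos
      have hK' : ∃ i ∈ Finset.Icc 1 n, moveToTop p n l K i ≠ 0 :=
        ⟨n, hn, by simp only [moveToTop, if_pos, ← hv]; omega⟩
      have hlift : (∃ (cs : List ℕ) (m : ℕ) (u : (ZMod p)ˣ), steenrodListLinear p n cs
            (∏ i ∈ Finset.Icc 1 n, dickson p n i ^ moveToTop p n l K i) =
              (u : ZMod p) • dickson p n n ^ p ^ m) →
          ∃ (cs : List ℕ) (m : ℕ) (u : (ZMod p)ˣ), steenrodListLinear p n cs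
            (∏ i ∈ Finset.Icc 1 n, dickson p n i ^ K i) =
              (u : ZMod p) • dickson p n n ^ p ^ m := by
        rintro ⟨ds, m, w, hds⟩
        refine ⟨ds ++ cs, m, u * w, ?_⟩
        rw [steenrodListLinear_append, hcs, map_smul, hds, smul_smul, Units.val_mul]
      by_cases hln : l = n
      · subst hln
        have hlow : ∀ j ∈ Finset.Ico 1 l, moveToTop p l l K j = K j := fun j hj => by
          simp [moveToTop, (Finset.mem_Ico.mp hj).2.ne]
        rcases Nat.eq_zero_or_pos d with rfl | hd0
        · rw [add_zero] at hd
          have hvL : v = L := by rw [hv, ← hd, padicValNat.prime_pow]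
          have hzero : ∀ j ∈ Finset.Icc 1 l, j ≠ l → dickson p l j ^ K j = 1 := by
            intro j hj hjl
            by_contra hne
            have hj0 : K j ≠ 0 := fun h => hne (by rw [h, pow_zero])
            have hj' : j ∈ Finset.Ico 1 l := by
              rw [Finset.mem_Icc] at hj
              rw [Finset.mem_Ico]
              omega
            have hle := hmin j hj hj0
            rw [hvL, dicksonLag, dicksonLag, if_pos rfl, if_neg hjl] at hle
            have h1 : p ^ L ≤ p ^ padicValNat p (K j) := Nat.pow_le_pow_right hp.pos (by omega)
            have h2 : p ^ padicValNat p (K j) ≤ K j :=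
              Nat.le_of_dvd (Nat.pos_of_ne_zero hj0) pow_padicValNat_dvd
            have h3 := hLlow j hj'
            omega
          refine ⟨[], L, 1, ?_⟩
          rw [Finset.prod_eq_single_of_mem l hn hzero, ← hd, Units.val_one, one_smul]
          rfl
        · have hvL : v ≤ L := by
            refine (Nat.pow_le_pow_iff_right hp.one_lt).mp ?_
            exact (Nat.le_of_dvd (Nat.pos_of_ne_zero hl0) hdvd).trans (by omega)
          have hdd : p ^ v ∣ d :=
            (Nat.dvd_add_right hdvd).mp (hd ▸ pow_dvd_pow p hvL)
          have hvd := Nat.le_of_dvd hd0 hdd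
          refine hlift (ihd (d - p ^ v) (by omega) _ hK' ?_ ?_ ?_)
          · rw [Finset.sum_congr rfl hlow, hS]
          · exact fun j hj => (hlow j hj).symm ▸ hLlow j hj
          · simp only [moveToTop, if_pos, ← hv]
            omega
      · refine hlift (ihS _ ?_ _ hK' rfl)
        have hl' : l ∈ Finset.Ico 1 n := by
          rw [Finset.mem_Icc] at hl
          rw [Finset.mem_Ico]
          omega
        rw [← hS]
        refine Finset.sum_lt_sum (fun j hj => ?_) ⟨l, hl', ?_⟩
        · rw [moveToTop, if_neg (Finset.mem_Ico.mp hj).2.ne]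
          split_ifs with h
          · rw [h]
            exact Nat.sub_le _ _
          · exact le_rfl
        · rw [moveToTop, if_neg hln, if_pos rfl, ← hv]
          omega

end

/-- Theorem: for every nonzero monomial `d^K = ∏ d_{n,i}^{k(i)}` there is a finite composite
`P^{p^{c_1}} ∘ ⋯ ∘ P^{p^{c_r}}` of Steenrod operations carrying `d^K` to a unit multiple of
`d_{n,n}^{p^m}` for some `m`. -/
theorem exists_steenrod_to_top_power (p n : ℕ) [Fact p.Prime] (K : ℕ → ℕ)
    (hK : ∃ i, 1 ≤ i ∧ i ≤ n ∧ K i ≠ 0) :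
    ∃ (cs : List ℕ) (m : ℕ) (u : (ZMod p)ˣ),
      steenrodList p n cs (∏ i ∈ Finset.Icc 1 n, dickson p n i ^ K i) =
        (u : ZMod p) • dickson p n n ^ p ^ m := by
  obtain ⟨i, h1, hn, hi⟩ := hK
  exact exists_steenrodListLinear_prod_dickson K ⟨i, Finset.mem_Icc.mpr ⟨h1, hn⟩, hi⟩
end

section
/- The augmentation ideal of the classical Dickson algebra is indecomposable as a Steenrod module: let D_n = F_p[d_{n,1},...,d_{n,n}] ⊆ F_p[y_1,...,y_n] and let D_n⁺ be its ideal of elements of positive degree (which is stable under all Steenrod operations P^k with k ≥ 1, and under all P^k). If M and N are graded F_p-linear subspaces of D_n⁺, each stable under every Steenrod operation P^k, such that D_n⁺ = M ⊕ N, then M = 0 or N = 0. -/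
open MvPolynomial Matrix

set_option synthInstance.maxHeartbeats 1000000
set_option maxHeartbeats 1000000

/-- The classical Dickson algebra `D_n = F_p[d_{n,1},...,d_{n,n}]` as a subalgebra of
`F_p[y_1,...,y_n]`. -/
noncomputable def DicksonSubalg (p n : ℕ) [NeZero p] :
    Subalgebra (ZMod p) (MvPolynomial (Fin n) (ZMod p)) :=
  Algebra.adjoin (ZMod p) (Set.range fun i : Fin n => dickson p n (i.val + 1))

/-- The augmentation ideal `D_n⁺` of the Dickson algebra: elements of `D_n` of positive
degree, i.e. with vanishing constant term (= value at `y = 0`). -/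
noncomputable def DicksonPlus (p n : ℕ) [NeZero p] :
    Submodule (ZMod p) (MvPolynomial (Fin n) (ZMod p)) :=
  Subalgebra.toSubmodule (DicksonSubalg p n) ⊓
    LinearMap.ker (aeval (R := ZMod p) fun _ : Fin n => (0 : ZMod p)).toLinearMap

/-- The derivation of `F_p[y_1,...,y_n]` with `y_i ↦ y_i^{p^j}`, the action of the Milnor
primitive `P^{Δ_j}`. -/
noncomputable def milnorDer (p n j : ℕ) :
    Derivation (ZMod p) (MvPolynomial (Fin n) (ZMod p)) (MvPolynomial (Fin n) (ZMod p)) :=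
  mkDerivation (ZMod p) fun i => X i ^ p ^ j

/-- The coefficientwise extension of a derivation of `A` to `A[t]`. -/
noncomputable def coeffwiseDer {R A : Type*} [CommRing R] [CommRing A] [Algebra R A]
    (d : Derivation R A A) : Derivation R (Polynomial A) (Polynomial A) :=
  PolynomialModule.equivPolynomialSelf.toLinearMap.compDer d.mapCoeffs

theorem coeff_coeffwiseDer {R A : Type*} [CommRing R] [CommRing A] [Algebra R A]
    (d : Derivation R A A) (f : Polynomial A) (k : ℕ) :
    (coeffwiseDer d f).coeff k = d (f.coeff k) := rfl

theorem coeffwiseDer_C {R A : Type*} [CommRing R] [CommRing A] [Algebra R A]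
    (d : Derivation R A A) (a : A) :
    coeffwiseDer d (Polynomial.C a) = Polynomial.C (d a) := by
  ext k
  rw [coeff_coeffwiseDer, Polynomial.coeff_C, Polynomial.coeff_C]
  split_ifs <;> simp

theorem coeffwiseDer_X {R A : Type*} [CommRing R] [CommRing A] [Algebra R A]
    (d : Derivation R A A) : coeffwiseDer d Polynomial.X = 0 := by
  ext k
  rw [coeff_coeffwiseDer, Polynomial.coeff_X]
  split_ifs <;> simp

theorem milnorDer_X (p n j : ℕ) (i : Fin n) : milnorDer p n j (X i) = X i ^ p ^ j :=
  mkDerivation_X _ _ _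

theorem Pt_X (p n : ℕ) (i : Fin n) :
    Pt p n (X i) = Polynomial.C (X i) + Polynomial.C (X i ^ p) * Polynomial.X :=
  aeval_X _ _

theorem derivation_pow_char {p : ℕ} {A : Type*} [CommRing A] [Algebra (ZMod p) A]
    (d : Derivation (ZMod p) A A) (a : A) {m : ℕ} (hm : p ∣ m) : d (a ^ m) = 0 := by
  have h : ((m : ℕ) : A) = 0 := by
    rw [← map_natCast (algebraMap (ZMod p) A), (ZMod.natCast_eq_zero_iff m p).2 hm, map_zero]
  rw [Derivation.leibniz_pow, nsmul_eq_mul, h, zero_mul]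

theorem Pt_milnorDer (p n j : ℕ) [Fact p.Prime] (f : MvPolynomial (Fin n) (ZMod p)) :
    Pt p n (milnorDer p n j f) = coeffwiseDer (milnorDer p n j) (Pt p n f) +
      Polynomial.X ^ p ^ j * coeffwiseDer (milnorDer p n (j + 1)) (Pt p n f) := by
  induction f using MvPolynomial.induction_on with
  | C a =>
    rw [← algebraMap_eq]
    simp only [AlgHom.commutes, Derivation.map_algebraMap, map_zero, mul_zero, add_zero]
  | add f g hf hg => simp only [map_add, hf, hg]; ring
  | mul_X f i hf =>
    have h1 : coeffwiseDer (milnorDer p n j) (Pt p n (X i)) = Polynomial.C (X i ^ p ^ j) := by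
      rw [Pt_X, map_add, Derivation.leibniz, coeffwiseDer_C, coeffwiseDer_C, coeffwiseDer_X,
        derivation_pow_char _ _ dvd_rfl, milnorDer_X]
      simp
    have h2 : coeffwiseDer (milnorDer p n (j + 1)) (Pt p n (X i)) =
        Polynomial.C (X i ^ p ^ (j + 1)) := by
      rw [Pt_X, map_add, Derivation.leibniz, coeffwiseDer_C, coeffwiseDer_C, coeffwiseDer_X,
        derivation_pow_char _ _ dvd_rfl, milnorDer_X]
      simp
    have h3 : Pt p n (X i ^ p ^ j) = Polynomial.C (X i ^ p ^ j) +
        Polynomial.X ^ p ^ j * Polynomial.C (X i ^ p ^ (j + 1)) := by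
      rw [map_pow, Pt_X, add_pow_char_pow, mul_pow]
      simp only [← Polynomial.C_pow, ← pow_mul, ← pow_succ']
      ring
    simp only [map_mul, Derivation.leibniz, smul_eq_mul, map_add, hf, milnorDer_X, h1, h2, h3]
    ring

theorem steenrod_zero (p n : ℕ) (f : MvPolynomial (Fin n) (ZMod p)) : steenrod p n 0 f = f := by
  unfold steenrod
  induction f using MvPolynomial.induction_on with
  | C a => rw [← algebraMap_eq, AlgHom.commutes, Polynomial.algebraMap_apply,
      Polynomial.coeff_C_zero]
  | add f g hf hg => rw [map_add, Polynomial.coeff_add, hf, hg]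
  | mul_X f i hf => rw [map_mul, Polynomial.mul_coeff_zero, hf, Pt_X]; simp

theorem steenrod_one (p n : ℕ) (f : MvPolynomial (Fin n) (ZMod p)) :
    steenrod p n 1 f = milnorDer p n 1 f := by
  unfold steenrod
  induction f using MvPolynomial.induction_on with
  | C a => rw [← algebraMap_eq, AlgHom.commutes, Polynomial.algebraMap_apply,
      Polynomial.coeff_C_succ, Derivation.map_algebraMap]
  | add f g hf hg => rw [map_add, Polynomial.coeff_add, hf, hg, map_add]
  | mul_X f i hf =>
    rw [map_mul, Polynomial.mul_coeff_one, hf, Pt_X, Derivation.leibniz, milnorDer_X]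
    have := steenrod_zero p n f
    unfold steenrod at this
    rw [this, Polynomial.coeff_add, Polynomial.coeff_add, Polynomial.coeff_C_mul,
      Polynomial.coeff_C_mul]
    simp [mul_comm]

theorem steenrod_milnorDer (p n j : ℕ) [Fact p.Prime] (f : MvPolynomial (Fin n) (ZMod p)) :
    steenrod p n (p ^ j) (milnorDer p n j f) =
      milnorDer p n j (steenrod p n (p ^ j) f) + milnorDer p n (j + 1) f := by
  have h0 := steenrod_zero p n f
  unfold steenrod at h0 ⊢
  rw [Pt_milnorDer, Polynomial.coeff_add, coeff_coeffwiseDer, mul_comm,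
    Polynomial.coeff_mul_X_pow', if_pos le_rfl, Nat.sub_self, coeff_coeffwiseDer, h0]

theorem steenrod_pow_char (p n k : ℕ) [Fact p.Prime] (f : MvPolynomial (Fin n) (ZMod p)) :
    steenrod p n (k * p) (f ^ p) = steenrod p n k f ^ p := by
  unfold steenrod
  rw [map_pow, ← Polynomial.map_frobenius_expand p, Polynomial.coeff_map,
    Polynomial.coeff_expand_mul (Fact.out : p.Prime).pos, frobenius_def]

/-- Stability of a subspace under all Steenrod operations. -/
def SteenrodStable (p n : ℕ) (M : Submodule (ZMod p) (MvPolynomial (Fin n) (ZMod p))) : Prop :=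
  ∀ x ∈ M, ∀ k : ℕ, steenrod p n k x ∈ M

theorem SteenrodStable.milnorDer_mem {p n : ℕ} [Fact p.Prime]
    {M : Submodule (ZMod p) (MvPolynomial (Fin n) (ZMod p))} (hM : SteenrodStable p n M)
    (j : ℕ) {x : MvPolynomial (Fin n) (ZMod p)} (hx : x ∈ M) : milnorDer p n (j + 1) x ∈ M := by
  induction j generalizing x with
  | zero => exact steenrod_one p n x ▸ hM x hx 1
  | succ j ih =>
    rw [← add_sub_cancel_left (milnorDer p n (j + 1) (steenrod p n (p ^ (j + 1)) x))
      (milnorDer p n (j + 1 + 1) x), ← steenrod_milnorDer]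
    exact M.sub_mem (hM _ (ih hx) _) (ih (hM _ hx _))

/-- The subspace of elements whose `p`-th power lies in `M`. -/
def frobeniusRoot (p n : ℕ) [Fact p.Prime]
    (M : Submodule (ZMod p) (MvPolynomial (Fin n) (ZMod p))) :
    Submodule (ZMod p) (MvPolynomial (Fin n) (ZMod p)) where
  carrier := {x | x ^ p ∈ M}
  add_mem' {a b} ha hb := by
    rw [Set.mem_ofPred_eq, add_pow_char]
    exact M.add_mem ha hb
  zero_mem' := by
    rw [Set.mem_ofPred_eq, zero_pow (Fact.out : p.Prime).ne_zero]
    exact M.zero_mem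
  smul_mem' c x hx := by
    rw [Set.mem_ofPred_eq, smul_pow]
    exact M.smul_mem _ hx

theorem mem_frobeniusRoot {p n : ℕ} [Fact p.Prime]
    {M : Submodule (ZMod p) (MvPolynomial (Fin n) (ZMod p))}
    {x : MvPolynomial (Fin n) (ZMod p)} : x ∈ frobeniusRoot p n M ↔ x ^ p ∈ M := Iff.rfl

theorem SteenrodStable.frobeniusRoot_stable {p n : ℕ} [Fact p.Prime]
    {M : Submodule (ZMod p) (MvPolynomial (Fin n) (ZMod p))} (hM : SteenrodStable p n M) :
    SteenrodStable p n (frobeniusRoot p n M) := fun x hx k => by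
  rw [mem_frobeniusRoot, ← steenrod_pow_char]
  exact hM _ hx _

/-- The `F_p`-linear combination `∑ v_j y_j`. -/
def primeFieldComb {p n : ℕ} {A : Type*} [CommRing A] [Algebra (ZMod p) A] (y : Fin n → A)
    (v : Fin n → ZMod p) : A :=
  ∑ j, algebraMap (ZMod p) A (v j) * y j

theorem primeFieldComb_neg {p n : ℕ} {A : Type*} [CommRing A] [Algebra (ZMod p) A]
    (y : Fin n → A) (v : Fin n → ZMod p) : primeFieldComb y (-v) = -primeFieldComb y v := by
  simp [primeFieldComb]

theorem primeFieldComb_zero {p n : ℕ} {A : Type*} [CommRing A] [Algebra (ZMod p) A]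
    (y : Fin n → A) : primeFieldComb y (0 : Fin n → ZMod p) = 0 := by
  simp [primeFieldComb]

theorem primeFieldComb_pow {p n : ℕ} [Fact p.Prime] {A : Type*} [CommRing A] [CharP A p]
    [Algebra (ZMod p) A] (y : Fin n → A) (v : Fin n → ZMod p) (i : ℕ) :
    primeFieldComb y v ^ p ^ i = ∑ j, algebraMap (ZMod p) A (v j) * y j ^ p ^ i := by
  simp only [primeFieldComb, sum_pow_char_pow, mul_pow, ← map_pow, ZMod.pow_card_pow]

theorem degree_sum_C_mul_X_pow_lt {p n : ℕ} [Fact p.Prime] {A : Type*} [CommRing A]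
    (a : Fin n → A) :
    (∑ i : Fin n, Polynomial.C (a i) * Polynomial.X ^ p ^ (i : ℕ)).degree < ((p ^ n : ℕ) : WithBot ℕ) := by
  refine (Polynomial.degree_sum_le _ _).trans_lt ((Finset.sup_lt_iff ?_).2 fun i _ => ?_)
  · exact WithBot.bot_lt_coe _
  · refine (Polynomial.degree_C_mul_X_pow_le _ _).trans_lt ?_
    exact_mod_cast Nat.pow_lt_pow_right (Fact.out : p.Prime).one_lt i.2

theorem eq_zero_of_degree_lt_of_eval_primeFieldComb {p n : ℕ} [Fact p.Prime] {A : Type*}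
    [CommRing A] [IsDomain A] [Algebra (ZMod p) A] {y : Fin n → A}
    (hy : Function.Injective (primeFieldComb (p := p) y)) {q : Polynomial A}
    (hq : q.degree < ((p ^ n : ℕ) : WithBot ℕ)) (h : ∀ v, q.eval (primeFieldComb (p := p) y v) = 0) :
    q = 0 := by
  by_contra h0
  refine h0 (Polynomial.eq_zero_of_natDegree_lt_card_of_eval_eq_zero q hy h ?_)
  rw [Fintype.card_fun, ZMod.card, Fintype.card_fin]
  exact (Polynomial.natDegree_lt_iff_degree_lt h0).2 hq

theorem moore_independent {p n : ℕ} [Fact p.Prime] {A : Type*} [CommRing A] [IsDomain A]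
    [CharP A p] [Algebra (ZMod p) A] {y : Fin n → A}
    (hy : Function.Injective (primeFieldComb (p := p) y)) {a : Fin n → A}
    (h : ∀ k, ∑ i : Fin n, a i * y k ^ p ^ (i : ℕ) = 0) : a = 0 := by
  have hq : ∑ i : Fin n, Polynomial.C (a i) * Polynomial.X ^ p ^ (i : ℕ) = 0 := by
    refine eq_zero_of_degree_lt_of_eval_primeFieldComb hy (degree_sum_C_mul_X_pow_lt a)
      fun v => ?_
    simp only [Polynomial.eval_finsetSum, Polynomial.eval_mul, Polynomial.eval_C,
      Polynomial.eval_pow, Polynomial.eval_X, primeFieldComb_pow, Finset.mul_sum]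
    rw [Finset.sum_comm]
    refine Finset.sum_eq_zero fun k _ => ?_
    rw [← mul_zero (algebraMap (ZMod p) A (v k)), ← h k, Finset.mul_sum]
    exact Finset.sum_congr rfl fun i _ => by ring
  funext i
  have := congrArg (fun q => Polynomial.coeff q (p ^ (i : ℕ))) hq
  simpa [Polynomial.finsetSum_coeff, Polynomial.coeff_X_pow,
    Nat.pow_right_inj (Fact.out : p.Prime).one_lt, Fin.val_inj] using this

theorem exists_frobenius_relation {p n : ℕ} [Fact p.Prime] {K : Type*} [Field K]
    [CharP K p] [Algebra (ZMod p) K] {y : Fin n → K}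
    (hy : Function.Injective (primeFieldComb (p := p) y)) :
    ∃ c : Fin n → K, ∀ k, y k ^ p ^ n = ∑ i : Fin n, c i * y k ^ p ^ (i : ℕ) := by
  let B : Matrix (Fin n) (Fin n) K := Matrix.of fun k i => y k ^ p ^ (i : ℕ)
  have hmul (a : Fin n → K) (k : Fin n) :
      (B *ᵥ a) k = ∑ i : Fin n, a i * y k ^ p ^ (i : ℕ) := by
    simp only [B, Matrix.mulVec, dotProduct, Matrix.of_apply, mul_comm]
  have hinj : Function.Injective B.mulVec := by
    refine (injective_iff_map_eq_zero B.mulVecLin).2 fun a ha => ?_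
    exact moore_independent hy fun k => (hmul a k).symm.trans (congrFun ha k)
  obtain ⟨c, hc⟩ := Matrix.mulVec_surjective_iff_isUnit.2
    (Matrix.mulVec_injective_iff_isUnit.1 hinj) fun k => y k ^ p ^ n
  exact ⟨c, fun k => by rw [← hmul, hc]⟩

theorem prod_X_add_primeFieldComb {p n : ℕ} [Fact p.Prime] {K : Type*} [Field K]
    [CharP K p] [Algebra (ZMod p) K] {y : Fin n → K}
    (hy : Function.Injective (primeFieldComb (p := p) y)) :
    ∃ c : Fin n → K, ∏ v : Fin n → ZMod p, (Polynomial.X + Polynomial.C (primeFieldComb y v)) =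
      Polynomial.X ^ p ^ n + ∑ i : Fin n, Polynomial.C (c i) * Polynomial.X ^ p ^ (i : ℕ) := by
  obtain ⟨c, hc⟩ := exists_frobenius_relation hy
  refine ⟨-c, ?_⟩
  set V := ∏ v : Fin n → ZMod p, (Polynomial.X + Polynomial.C (primeFieldComb y v)) with hV
  set W := Polynomial.X ^ p ^ n +
    ∑ i : Fin n, Polynomial.C ((-c) i) * Polynomial.X ^ p ^ (i : ℕ) with hW
  have hVm : V.Monic := Polynomial.monic_prod_of_monic _ _ fun v _ => Polynomial.monic_X_add_C _
  have hVd : V.degree = ((p ^ n : ℕ) : WithBot ℕ) := by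
    rw [hV, Polynomial.degree_prod]
    simp [Polynomial.degree_X_add_C]
  have hlt := degree_sum_C_mul_X_pow_lt (p := p) (-c)
  have hWm : W.Monic := Polynomial.monic_X_pow_add hlt
  have hWd : W.degree = ((p ^ n : ℕ) : WithBot ℕ) := by
    rw [hW, Polynomial.degree_add_eq_left_of_degree_lt, Polynomial.degree_X_pow]
    rwa [Polynomial.degree_X_pow]
  refine sub_eq_zero.1 (eq_zero_of_degree_lt_of_eval_primeFieldComb hy ?_ fun v => ?_)
  · rw [← hVd]
    exact Polynomial.degree_sub_lt_left (hVd.trans hWd.symm) hVm.ne_zero (by rw [hVm, hWm])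
  · have h1 : V.eval (primeFieldComb y v) = 0 := by
      rw [hV, Polynomial.eval_prod]
      refine Finset.prod_eq_zero (Finset.mem_univ (-v)) ?_
      simp [primeFieldComb_neg]
    have h2 : W.eval (primeFieldComb y v) = 0 := by
      simp only [hW, Polynomial.eval_add, Polynomial.eval_finsetSum, Polynomial.eval_mul,
        Polynomial.eval_C, Polynomial.eval_pow, Polynomial.eval_X, primeFieldComb_pow,
        Finset.mul_sum, hc]
      rw [Finset.sum_comm, ← Finset.sum_add_distrib]
      refine Finset.sum_eq_zero fun i _ => ?_
      rw [← Finset.sum_add_distrib]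
      refine Finset.sum_eq_zero fun k _ => ?_
      rw [Pi.neg_apply]
      ring
    rw [Polynomial.eval_sub, h1, h2, sub_zero]

theorem primeFieldComb_X_injective (p n : ℕ) :
    Function.Injective
      (primeFieldComb (p := p) (X : Fin n → MvPolynomial (Fin n) (ZMod p))) := fun v w h => by
  classical
  funext k
  have := congrArg (coeff (Finsupp.single k 1)) h
  simpa [primeFieldComb, algebraMap_eq, coeff_sum, coeff_C_mul, coeff_X,
    Finsupp.single_left_inj] using this

/-- The polynomial `∏_v (X + v·y)` over `F_p[y_1,...,y_n]`. -/
noncomputable def dicksonPoly (p n : ℕ) [NeZero p] : Polynomial (MvPolynomial (Fin n) (ZMod p)) :=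
  ∏ v : Fin n → ZMod p, (Polynomial.X + Polynomial.C (primeFieldComb X v))

/-- The coefficient of `X^{p^i}` in `∏_v (X + v·y)`: up to sign, `d_{n,n-i}`. -/
noncomputable def dicksonCoeff (p n : ℕ) [NeZero p] (i : ℕ) : MvPolynomial (Fin n) (ZMod p) :=
  (dicksonPoly p n).coeff (p ^ i)

theorem dicksonPoly_eq (p n : ℕ) [Fact p.Prime] :
    dicksonPoly p n = Polynomial.X ^ p ^ n +
      ∑ i : Fin n, Polynomial.C (dicksonCoeff p n i) * Polynomial.X ^ p ^ (i : ℕ) := by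
  let A := MvPolynomial (Fin n) (ZMod p)
  let K := FractionRing A
  have hinj : Function.Injective (algebraMap A K) := IsFractionRing.injective A K
  have : CharP K p := charP_of_injective_algebraMap hinj p
  have hcomb (v : Fin n → ZMod p) :
      primeFieldComb (fun k => algebraMap A K (X k)) v = algebraMap A K (primeFieldComb X v) := by
    simp only [primeFieldComb, map_sum, map_mul, ← IsScalarTower.algebraMap_apply]
  have hy : Function.Injective (primeFieldComb (p := p) fun k => algebraMap A K (X k)) :=
    fun v w h => primeFieldComb_X_injective p n (hinj (by simpa only [hcomb] using h))
  obtain ⟨c, hc⟩ := prod_X_add_primeFieldComb hy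
  have hmap : (dicksonPoly p n).map (algebraMap A K) = Polynomial.X ^ p ^ n +
      ∑ i : Fin n, Polynomial.C (c i) * Polynomial.X ^ p ^ (i : ℕ) := by
    rw [← hc, dicksonPoly, Polynomial.map_prod]
    simp only [Polynomial.map_add, Polynomial.map_X, Polynomial.map_C, hcomb]
  have hone := (Fact.out : p.Prime).one_lt
  have hcoeff (i : Fin n) : algebraMap A K (dicksonCoeff p n i) = c i := by
    rw [dicksonCoeff, ← Polynomial.coeff_map, hmap]
    simp [Polynomial.coeff_X_pow, Nat.pow_right_inj hone, Fin.val_inj, i.2.ne]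
  refine Polynomial.map_injective _ hinj ?_
  rw [hmap]
  simp only [Polynomial.map_add, Polynomial.map_pow, Polynomial.map_X, Polynomial.map_sum,
    Polynomial.map_mul, Polynomial.map_C, hcoeff]

theorem dicksonCoeff_relation (p n : ℕ) [Fact p.Prime] (k : Fin n) :
    X k ^ p ^ n + ∑ i : Fin n, dicksonCoeff p n i * X k ^ p ^ (i : ℕ) = 0 := by
  have h : (dicksonPoly p n).eval (X k) = 0 := by
    rw [dicksonPoly, Polynomial.eval_prod]
    refine Finset.prod_eq_zero (Finset.mem_univ (-Pi.single k 1)) ?_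
    rw [primeFieldComb_neg]
    simp [primeFieldComb, Pi.single_apply]
  rw [dicksonPoly_eq] at h
  simpa [Polynomial.eval_finsetSum] using h

theorem milnorDer_relation (p n j : ℕ) [Fact p.Prime] (k : Fin (n + 1)) :
    ∑ i : Fin (n + 1), milnorDer p (n + 1) j (dicksonCoeff p (n + 1) i) * X k ^ p ^ (i : ℕ) +
      dicksonCoeff p (n + 1) 0 * X k ^ p ^ j = 0 := by
  have h := congrArg (milnorDer p (n + 1) j) (dicksonCoeff_relation p (n + 1) k)
  rw [map_add, derivation_pow_char _ _ (dvd_pow_self p n.succ_ne_zero), zero_add, map_sum,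
    map_zero] at h
  simp only [Derivation.leibniz, Finset.sum_add_distrib, smul_eq_mul] at h
  rw [Fin.sum_univ_succ, Finset.sum_eq_zero, add_zero] at h
  · rw [← h, Fin.val_zero, pow_zero, pow_one, milnorDer_X]
    simp only [mul_comm (X k ^ _)]
    exact add_comm _ _
  · intro i _
    rw [derivation_pow_char _ _ (dvd_pow_self p (by simp)), mul_zero]

theorem milnorDer_dicksonCoeff_of_lt (p n : ℕ) [Fact p.Prime] (i j : Fin (n + 1)) :
    milnorDer p (n + 1) j (dicksonCoeff p (n + 1) i) =
      if i = j then -dicksonCoeff p (n + 1) 0 else 0 := by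
  have h := moore_independent (primeFieldComb_X_injective p (n + 1))
    (a := fun i : Fin (n + 1) => milnorDer p (n + 1) j (dicksonCoeff p (n + 1) i) +
      if i = j then dicksonCoeff p (n + 1) 0 else 0) fun k => by
        simpa [add_mul, Finset.sum_add_distrib] using milnorDer_relation p n j k
  have := eq_neg_of_add_eq_zero_left (congrFun h i)
  rw [this]
  split_ifs <;> simp

theorem milnorDer_dicksonCoeff_self (p n : ℕ) [Fact p.Prime] (i : Fin (n + 1)) :
    milnorDer p (n + 1) (n + 1) (dicksonCoeff p (n + 1) i) =
      dicksonCoeff p (n + 1) 0 * dicksonCoeff p (n + 1) i := by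
  have h := moore_independent (primeFieldComb_X_injective p (n + 1))
    (a := fun i : Fin (n + 1) => milnorDer p (n + 1) (n + 1) (dicksonCoeff p (n + 1) i) -
      dicksonCoeff p (n + 1) 0 * dicksonCoeff p (n + 1) i) fun k => by
        have h1 := milnorDer_relation p n (n + 1) k
        rw [eq_neg_of_add_eq_zero_left (dicksonCoeff_relation p (n + 1) k)] at h1
        simpa only [sub_mul, Finset.sum_sub_distrib, mul_assoc, Finset.mul_sum, mul_neg,
          ← sub_eq_add_neg] using h1
  exact sub_eq_zero.1 (congrFun h i)

theorem dicksonCoeff_zero_ne_zero (p n : ℕ) [Fact p.Prime] : dicksonCoeff p n 0 ≠ 0 := by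
  classical
  have hprod : dicksonPoly p n = Polynomial.X *
      ∏ v ∈ Finset.univ.erase (0 : Fin n → ZMod p),
        (Polynomial.X + Polynomial.C (primeFieldComb X v)) := by
    rw [dicksonPoly, ← Finset.mul_prod_erase _ _ (Finset.mem_univ 0), primeFieldComb_zero,
      Polynomial.C_0, add_zero]
  rw [dicksonCoeff, pow_zero, hprod, ← zero_add 1,
    Polynomial.coeff_X_mul, Polynomial.coeff_zero_prod]
  refine Finset.prod_ne_zero_iff.2 fun v hv => ?_
  rw [Polynomial.coeff_add, Polynomial.coeff_X_zero, zero_add, Polynomial.coeff_C_zero,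
    ← primeFieldComb_zero (p := p) X]
  exact (primeFieldComb_X_injective p n).ne (Finset.ne_of_mem_erase hv)

theorem dickson_eq (p n i : ℕ) [NeZero p] :
    dickson p n i = (-1) ^ i * dicksonCoeff p n (n - i) := rfl

theorem aeval_zero_dicksonCoeff (p n : ℕ) [Fact p.Prime] (i : Fin n) :
    aeval (R := ZMod p) (fun _ : Fin n => (0 : ZMod p)) (dicksonCoeff p n i) = 0 := by
  have h : (dicksonPoly p n).map
      (aeval (R := ZMod p) fun _ : Fin n => (0 : ZMod p)).toRingHom = Polynomial.X ^ p ^ n := by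
    rw [dicksonPoly, Polynomial.map_prod]
    simp [primeFieldComb, Polynomial.map_sum]
  have h' := congrArg (fun q => Polynomial.coeff q (p ^ (i : ℕ))) h
  rw [Polynomial.coeff_map, Polynomial.coeff_X_pow, if_neg] at h'
  · exact h'
  · exact (Nat.pow_lt_pow_right (Fact.out : p.Prime).one_lt i.2).ne

theorem derivation_aeval {R σ A : Type*} [CommRing R] [CommRing A] [Algebra R A] [Fintype σ]
    (d : Derivation R A A) (c : σ → A) (F : MvPolynomial σ R) :
    d (aeval c F) = ∑ i, aeval c (pderiv i F) * d (c i) := by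
  classical
  induction F using MvPolynomial.induction_on with
  | C a => simp [← algebraMap_eq]
  | add F G hF hG => simp only [map_add, hF, hG, add_mul, Finset.sum_add_distrib]
  | mul_X F i hF =>
    simp only [map_mul, Derivation.leibniz, smul_eq_mul, hF, map_add, add_mul,
      Finset.sum_add_distrib, aeval_X, Finset.mul_sum, pderiv_X, Pi.single_apply]
    congr 1
    · simp
    · exact Finset.sum_congr rfl fun j _ => by ring

theorem exists_pow_char_eq {p : ℕ} [Fact p.Prime] {σ : Type*} {F : MvPolynomial σ (ZMod p)}
    (h : ∀ m ∈ F.support, ∀ i, p ∣ m i) :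
    ∃ G : MvPolynomial σ (ZMod p), G ^ p = F ∧ ∀ m ∈ G.support, p • m ∈ F.support := by
  let G : MvPolynomial σ (ZMod p) :=
    ∑ m ∈ F.support, monomial (m.mapRange (· / p) (Nat.zero_div p)) (coeff m F)
  have hG : expand p G = F := by
    conv_rhs => rw [F.as_sum]
    simp only [G, map_sum, expand_monomial]
    refine Finset.sum_congr rfl fun m hm => ?_
    have hm' : p • m.mapRange (· / p) (Nat.zero_div p) = m := by
      ext i
      simp [Nat.mul_div_cancel' (h m hm i)]
    rw [hm']
  refine ⟨G, by rw [← expand_zmod, hG], fun m hm => ?_⟩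
  rw [mem_support_iff] at hm ⊢
  rwa [← hG, coeff_expand_smul _ (Fact.out : p.Prime).ne_zero]

/-- The operator `F ↦ X_0 · E F`, with `E = ∑ X_i ∂_i` the Euler derivation. -/
noncomputable def eulerShift {R : Type*} [CommRing R] {n : ℕ}
    (F : MvPolynomial (Fin (n + 1)) R) : MvPolynomial (Fin (n + 1)) R :=
  X 0 * ∑ i, X i * pderiv i F

theorem coeff_sum_X_mul_pderiv {R σ : Type*} [CommRing R] [Fintype σ] (F : MvPolynomial σ R)
    (m : σ →₀ ℕ) : coeff m (∑ i, X i * pderiv i F) = (∑ i, m i : ℕ) * coeff m F := by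
  classical
  induction F using MvPolynomial.induction_on' with
  | add F G hF hG =>
    simp only [map_add, mul_add, Finset.sum_add_distrib, coeff_add, hF, hG]
  | monomial u a =>
    simp only [X_mul_pderiv_monomial, ← Finset.sum_smul, coeff_smul, coeff_monomial]
    split_ifs with h <;> simp [h]

theorem mem_support_X_mul_iff {R σ : Type*} [CommRing R] {F : MvPolynomial σ R} {i : σ}
    {m' : σ →₀ ℕ} :
    m' ∈ (X i * F).support ↔ ∃ m ∈ F.support, m' = m + Finsupp.single i 1 := by
  rw [support_X_mul]
  simp [add_comm, eq_comm]

theorem mem_support_eulerShift_iff {R : Type*} [CommRing R] [IsDomain R] {n : ℕ}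
    {F : MvPolynomial (Fin (n + 1)) R} {m' : Fin (n + 1) →₀ ℕ} :
    m' ∈ (eulerShift F).support ↔ ∃ m ∈ F.support, m' = m + Finsupp.single 0 1 ∧
      ((∑ i, m i : ℕ) : R) ≠ 0 := by
  rw [eulerShift, mem_support_X_mul_iff]
  simp only [mem_support_iff, coeff_sum_X_mul_pderiv, ne_eq, mul_eq_zero, not_or]
  exact exists_congr fun m => by tauto

theorem mem_support_iterate_eulerShift_iff {R : Type*} [CommRing R] [IsDomain R] {n : ℕ}
    {F : MvPolynomial (Fin (n + 1)) R} (s : ℕ) {m' : Fin (n + 1) →₀ ℕ} :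
    m' ∈ (eulerShift^[s] F).support ↔ ∃ m ∈ F.support, m' = m + Finsupp.single 0 s ∧
      ∀ u < s, ((∑ i, m i : ℕ) : R) + u ≠ 0 := by
  induction s generalizing m' with
  | zero => simp
  | succ s ih =>
    have hsum (m : Fin (n + 1) →₀ ℕ) :
        ∑ i, (m + Finsupp.single 0 s : Fin (n + 1) →₀ ℕ) i = ∑ i, m i + s := by
      simp [Finset.sum_add_distrib, Finsupp.single_apply]
    rw [Function.iterate_succ_apply', mem_support_eulerShift_iff]
    constructor
    · rintro ⟨_, hm', rfl, hne⟩
      obtain ⟨m, hm, rfl, hu⟩ := ih.1 hm'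
      refine ⟨m, hm, by rw [add_assoc, Finsupp.single_add], fun u hus => ?_⟩
      rcases Nat.lt_succ_iff_lt_or_eq.1 hus with h | rfl
      · exact hu u h
      · rwa [hsum, Nat.cast_add] at hne
    · rintro ⟨m, hm, rfl, hu⟩
      refine ⟨m + Finsupp.single 0 s, ih.2 ⟨m, hm, rfl, fun u h => hu u (h.trans s.lt_succ_self)⟩,
        by rw [add_assoc, Finsupp.single_add], ?_⟩
      rw [hsum, Nat.cast_add]
      exact hu s s.lt_succ_self

theorem exists_common_shift {p : ℕ} [Fact p.Prime] {S : Finset (ZMod p)} (hS : S.Nonempty) :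
    ∃ s < p, (∃ a ∈ S, ∀ u < s, a + (u : ZMod p) ≠ 0) ∧
      ∀ a ∈ S, (∀ u < s, a + (u : ZMod p) ≠ 0) → a + (s : ZMod p) = 0 := by
  obtain ⟨a, ha, hmax⟩ := S.exists_max_image (fun a => (-a).val) hS
  have hval (b : ZMod p) : b + ((-b).val : ZMod p) = 0 := by simp
  refine ⟨(-a).val, ZMod.val_lt _, ⟨a, ha, fun u hu h => ?_⟩, fun b hb h => ?_⟩
  · rw [← neg_eq_iff_add_eq_zero] at h
    rw [h, ZMod.val_natCast] at hu
    exact (Nat.mod_le u p).not_gt hu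
  · have hle : (-a).val ≤ (-b).val := not_lt.1 fun hlt => h _ hlt (hval b)
    rw [hle.antisymm (hmax b hb)]
    exact hval b

/-- Polynomials in the Dickson invariants, with `X_i` evaluated at the coefficient of
`X^{p^i}`. -/
noncomputable def dicksonEval (p n : ℕ) [NeZero p] :
    MvPolynomial (Fin n) (ZMod p) →ₐ[ZMod p] MvPolynomial (Fin n) (ZMod p) :=
  aeval fun i : Fin n => dicksonCoeff p n i

section Descent

variable {p n : ℕ} [Fact p.Prime]
  {M : Submodule (ZMod p) (MvPolynomial (Fin (n + 1)) (ZMod p))}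

theorem SteenrodStable.dicksonEval_X_mul_pderiv_mem (hM : SteenrodStable p (n + 1) M)
    {F : MvPolynomial (Fin (n + 1)) (ZMod p)} (hF : dicksonEval p (n + 1) F ∈ M)
    {i : Fin (n + 1)} (hi : i ≠ 0) : dicksonEval p (n + 1) (X 0 * pderiv i F) ∈ M := by
  obtain ⟨j, hj⟩ := Nat.exists_eq_succ_of_ne_zero (Fin.val_ne_zero_iff.2 hi)
  have h : milnorDer p (n + 1) i (dicksonEval p (n + 1) F) ∈ M := by
    rw [hj]
    exact hM.milnorDer_mem j hF
  rw [dicksonEval, derivation_aeval] at h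
  simp only [milnorDer_dicksonCoeff_of_lt, mul_ite, mul_zero, Finset.sum_ite_eq',
    Finset.mem_univ, if_true] at h
  rw [mul_neg, M.neg_mem_iff] at h
  simpa [dicksonEval, mul_comm] using h

theorem SteenrodStable.dicksonEval_eulerShift_mem (hM : SteenrodStable p (n + 1) M)
    {F : MvPolynomial (Fin (n + 1)) (ZMod p)} (hF : dicksonEval p (n + 1) F ∈ M) :
    dicksonEval p (n + 1) (eulerShift F) ∈ M := by
  have h := hM.milnorDer_mem n hF
  rw [dicksonEval, derivation_aeval] at h
  simp only [milnorDer_dicksonCoeff_self] at h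
  convert h using 1
  simp only [dicksonEval, eulerShift, map_mul, map_sum, aeval_X, Finset.mul_sum, Fin.val_zero]
  exact Finset.sum_congr rfl fun i _ => by ring

theorem dvd_of_pderiv_eq_zero {σ : Type*} {F : MvPolynomial σ (ZMod p)} {i : σ}
    (h : pderiv i F = 0) {m : σ →₀ ℕ} (hm : m ∈ F.support) : p ∣ m i := by
  by_cases h0 : m i = 0
  · exact h0 ▸ dvd_zero p
  have hadd : m - Finsupp.single i 1 + Finsupp.single i 1 = m :=
    Finsupp.sub_add_single_one_cancel h0
  have hc := coeff_pderiv (i := i) F (m - Finsupp.single i 1)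
  rw [h, coeff_zero, hadd, eq_comm, mul_eq_zero] at hc
  have hc := hc.resolve_left (mem_support_iff.1 hm)
  rw [← ZMod.natCast_eq_zero_iff, ← hc]
  conv_lhs => rw [← hadd]
  simp

/-- Every nonzero polynomial without constant term in the Dickson invariants can be carried by
Steenrod operations to a power `d_{n,n}^{p^b}`, up to a unit. -/
theorem SteenrodStable.exists_dicksonCoeff_zero_pow_mem (W : ℕ)
    (hM : SteenrodStable p (n + 1) M) {F : MvPolynomial (Fin (n + 1)) (ZMod p)}
    (hF : dicksonEval p (n + 1) F ∈ M) (hF0 : F ≠ 0) (hconst : 0 ∉ F.support)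
    (hW : ∀ m ∈ F.support, Finsupp.weight (fun i => if i = 0 then 1 else 2) m ≤ W) :
    ∃ b : ℕ, dicksonCoeff p (n + 1) 0 ^ p ^ b ∈ M := by
  have hw0 (m : Fin (n + 1) →₀ ℕ)
      (hm : Finsupp.weight (fun i : Fin (n + 1) => if i = 0 then 1 else 2) m = 0) : m = 0 := by
    rw [Finsupp.weight_eq_sum, Finset.sum_eq_zero_iff] at hm
    ext i
    have := hm i (Finset.mem_univ i)
    split_ifs at this <;> simpa using this
  obtain ⟨m₀, hm₀⟩ := support_nonempty.2 hF0
  induction W generalizing M F m₀ with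
  | zero => exact absurd (hw0 m₀ (Nat.le_zero.1 (hW m₀ hm₀)) ▸ hm₀) hconst
  | succ W ih =>
    have hp := (Fact.out : p.Prime).two_le
    rcases Nat.eq_zero_or_pos W with rfl | hWpos
    · have hsupp (m) (hm : m ∈ F.support) : m = Finsupp.single 0 1 := by
        have hle := hW m hm
        obtain ⟨i, hi⟩ := Finsupp.ne_iff.1 fun h : m = 0 => hconst (h ▸ hm)
        have hsub := Finsupp.weight_sub_single_add
          (w := fun i : Fin (n + 1) => if i = 0 then 1 else 2) hi
        have hi0 : i = 0 := by
          by_contra hne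
          rw [if_neg hne] at hsub
          omega
        rw [hi0, if_pos rfl] at hsub
        rw [← Finsupp.sub_add_single_one_cancel hi, hi0, hw0 (m - Finsupp.single 0 1) (by omega),
          zero_add]
      have hFeq : F = monomial (Finsupp.single 0 1) (coeff m₀ F) := by
        conv_lhs => rw [F.as_sum]
        rw [Finset.sum_eq_single_of_mem m₀ hm₀ fun m hm hne =>
          absurd ((hsupp m hm).trans (hsupp m₀ hm₀).symm) hne, ← hsupp m₀ hm₀]
      refine ⟨0, ?_⟩
      rw [hFeq, dicksonEval, aeval_monomial, Finsupp.prod_single_index (by simp), pow_one,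
        ← Algebra.smul_def] at hF
      rw [pow_zero, pow_one]
      exact (M.smul_mem_iff (mem_support_iff.1 hm₀)).1 hF
    by_cases hd : ∃ i : Fin (n + 1), i ≠ 0 ∧ pderiv i F ≠ 0
    · obtain ⟨i, hi, hne⟩ := hd
      have hne' : X 0 * pderiv i F ≠ 0 := mul_ne_zero (X_ne_zero 0) hne
      obtain ⟨m₁, hm₁⟩ := support_nonempty.2 hne'
      refine ih hM (hM.dicksonEval_X_mul_pderiv_mem hF hi) hne' (fun h => ?_) (fun m' h => ?_) m₁ hm₁
      · obtain ⟨m, -, hm⟩ := mem_support_X_mul_iff.1 h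
        simpa using (DFunLike.congr_fun hm 0).symm
      · obtain ⟨m, hm, rfl⟩ := mem_support_X_mul_iff.1 h
        rw [mem_support_iff, coeff_pderiv] at hm
        have := hW _ (mem_support_iff.2 (left_ne_zero_of_mul hm))
        rw [map_add, Finsupp.weight_single] at this ⊢
        simp only [hi, if_false, if_true, smul_eq_mul, one_mul] at this ⊢
        omega
    · push Not at hd
      obtain ⟨s, hsp, ⟨a, ha, hsurv⟩, hzero⟩ := exists_common_shift
        (S := F.support.image fun m => ((∑ i, m i : ℕ) : ZMod p)) ⟨_, Finset.mem_image_of_mem _ hm₀⟩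
      obtain ⟨m₁, hm₁, rfl⟩ := Finset.mem_image.1 ha
      have hmem : dicksonEval p (n + 1) (eulerShift^[s] F) ∈ M := by
        clear * - hM hF
        induction s with
        | zero => exact hF
        | succ s ihs =>
          rw [Function.iterate_succ_apply']
          exact hM.dicksonEval_eulerShift_mem ihs
      have hdvd : ∀ m' ∈ (eulerShift^[s] F).support, ∀ i, p ∣ m' i := by
        intro m' hm'
        obtain ⟨m, hm, rfl, hu⟩ := (mem_support_iterate_eulerShift_iff s).1 hm'
        have hz := hzero _ (Finset.mem_image_of_mem _ hm) hu
        have hsucc (i : Fin n) : p ∣ m i.succ :=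
          dvd_of_pderiv_eq_zero (hd _ i.succ_ne_zero) hm
        rw [← Nat.cast_add, ZMod.natCast_eq_zero_iff, Fin.sum_univ_succ, add_right_comm,
          ← Nat.dvd_add_iff_left (Finset.dvd_sum fun i _ => hsucc i)] at hz
        refine Fin.cases ?_ fun i => ?_
        · simpa using hz
        · simpa [Finsupp.single_apply] using hsucc i
      obtain ⟨G, hG, hGsupp⟩ := exists_pow_char_eq hdvd
      have hG0 : G ≠ 0 := by
        rintro rfl
        have hm' := (mem_support_iterate_eulerShift_iff s).2 ⟨m₁, hm₁, rfl, hsurv⟩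
        rw [← hG, zero_pow (by omega)] at hm'
        simp at hm'
      obtain ⟨m₂, hm₂⟩ := support_nonempty.2 hG0
      have hGconst : 0 ∉ G.support := by
        intro h
        obtain ⟨m, hm, hm0, -⟩ := (mem_support_iterate_eulerShift_iff s).1 (hGsupp 0 h)
        rw [smul_zero, eq_comm, add_eq_zero] at hm0
        exact hconst (hm0.1 ▸ hm)
      have hGW : ∀ m ∈ G.support,
          Finsupp.weight (fun i : Fin (n + 1) => if i = 0 then 1 else 2) m ≤ W := by
        intro m h
        obtain ⟨m', hm', hmm, -⟩ := (mem_support_iterate_eulerShift_iff s).1 (hGsupp m h)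
        have hle := hW m' hm'
        have heq := congrArg
          (Finsupp.weight fun i : Fin (n + 1) => if i = 0 then 1 else 2) hmm
        rw [map_nsmul, map_add, Finsupp.weight_single, if_pos rfl] at heq
        simp only [smul_eq_mul, mul_one] at heq
        by_contra! hgt
        nlinarith [Nat.mul_le_mul_left p hgt]
      have hGmem : dicksonEval p (n + 1) G ∈ frobeniusRoot p (n + 1) M := by
        rwa [mem_frobeniusRoot, ← map_pow, hG]
      obtain ⟨b, hb⟩ := ih hM.frobeniusRoot_stable hGmem hG0 hGconst hGW m₂ hm₂
      exact ⟨b + 1, by rwa [mem_frobeniusRoot, ← pow_mul, ← pow_succ] at hb⟩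

theorem SteenrodStable.dicksonCoeff_zero_pow_succ_mem (hM : SteenrodStable p (n + 1) M) {b : ℕ}
    (hb : dicksonCoeff p (n + 1) 0 ^ p ^ b ∈ M) : dicksonCoeff p (n + 1) 0 ^ p ^ (b + 1) ∈ M := by
  induction b generalizing M with
  | zero =>
    have hk (k : ℕ) (hkp : k < p) : dicksonCoeff p (n + 1) 0 ^ (k + 1) ∈ M := by
      induction k with
      | zero => simpa using hb
      | succ k ih =>
        have h := hM.milnorDer_mem n (ih (k.lt_succ_self.trans hkp))
        rw [Derivation.leibniz_pow, ← Fin.val_zero (n + 1), milnorDer_dicksonCoeff_self,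
          Fin.val_zero, Nat.add_sub_cancel, smul_eq_mul, ← pow_two, ← pow_add,
          ← Nat.cast_smul_eq_nsmul (ZMod p)] at h
        refine (M.smul_mem_iff fun h0 => ?_).1 h
        exact Nat.not_dvd_of_pos_of_lt k.succ_pos hkp ((ZMod.natCast_eq_zero_iff _ _).1 h0)
    have hp := (Fact.out : p.Prime).pos
    have := hk (p - 1) (Nat.sub_lt hp one_pos)
    rw [Nat.sub_add_cancel (show 1 ≤ p from hp)] at this
    simpa using this
  | succ b ih =>
    have := ih hM.frobeniusRoot_stable (by rwa [mem_frobeniusRoot, ← pow_mul, ← pow_succ])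
    rwa [mem_frobeniusRoot, ← pow_mul, ← pow_succ] at this

theorem SteenrodStable.dicksonCoeff_zero_pow_mem_of_le (hM : SteenrodStable p (n + 1) M)
    {b b' : ℕ} (h : b ≤ b') (hb : dicksonCoeff p (n + 1) 0 ^ p ^ b ∈ M) :
    dicksonCoeff p (n + 1) 0 ^ p ^ b' ∈ M :=
  Nat.le_induction hb (fun _ _ => hM.dicksonCoeff_zero_pow_succ_mem) b' h

end Descent

theorem exists_dicksonEval_eq {p n : ℕ} [Fact p.Prime] {x : MvPolynomial (Fin n) (ZMod p)}
    (hx : x ∈ DicksonPlus p n) : ∃ F, dicksonEval p n F = x ∧ 0 ∉ F.support := by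
  obtain ⟨hx, hx0⟩ := Submodule.mem_inf.1 hx
  have hle : DicksonSubalg p n ≤ (dicksonEval p n).range := by
    refine Algebra.adjoin_le ?_
    rintro _ ⟨i, rfl⟩
    refine ⟨(-1) ^ (i.val + 1) * X i.rev, ?_⟩
    simp [dicksonEval, dickson_eq, Fin.val_rev]
  obtain ⟨F, rfl⟩ := hle hx
  refine ⟨F, rfl, ?_⟩
  have hcomp : (aeval (R := ZMod p) fun _ : Fin n => (0 : ZMod p)).comp (dicksonEval p n) =
      aeval (R := ZMod p) fun _ : Fin n => (0 : ZMod p) := by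
    ext i
    rw [AlgHom.comp_apply, dicksonEval, aeval_X, aeval_zero_dicksonCoeff, aeval_X]
  have h0 := DFunLike.congr_fun hcomp F
  rw [AlgHom.comp_apply, show aeval (fun _ : Fin n => (0 : ZMod p)) (dicksonEval p n F) = 0 from
    hx0] at h0
  rw [notMem_support_iff]
  simpa [constantCoeff_eq] using h0.symm

theorem SteenrodStable.exists_pow_mem_of_ne_bot {p n : ℕ} [Fact p.Prime]
    {M : Submodule (ZMod p) (MvPolynomial (Fin (n + 1)) (ZMod p))}
    (hM : SteenrodStable p (n + 1) M) (hle : M ≤ DicksonPlus p (n + 1)) (hne : M ≠ ⊥) :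
    ∃ b : ℕ, dicksonCoeff p (n + 1) 0 ^ p ^ b ∈ M := by
  obtain ⟨x, hx, hx0⟩ := M.ne_bot_iff.1 hne
  obtain ⟨F, rfl, hF⟩ := exists_dicksonEval_eq (hle hx)
  exact hM.exists_dicksonCoeff_zero_pow_mem _ hx (fun h => hx0 (by rw [h, map_zero])) hF
    fun m hm => Finset.le_sup (f := Finsupp.weight fun i : Fin (n + 1) => if i = 0 then 1 else 2) hm

/-- The augmentation ideal of the Dickson algebra is indecomposable as a Steenrod module:
if `D_n⁺ = M ⊕ N` with `M, N` graded subspaces stable under all Steenrod operations `P^k`,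
then `M = 0` or `N = 0`. -/
theorem dicksonPlus_indecomposable (p n : ℕ) [Fact p.Prime]
    (M N : Submodule (ZMod p) (MvPolynomial (Fin n) (ZMod p)))
    (hM : M ≤ DicksonPlus p n) (hN : N ≤ DicksonPlus p n)
    (hMgr : ∀ x ∈ M, ∀ k : ℕ, MvPolynomial.homogeneousComponent k x ∈ M)
    (hNgr : ∀ x ∈ N, ∀ k : ℕ, MvPolynomial.homogeneousComponent k x ∈ N)
    (hMP : ∀ x ∈ M, ∀ k : ℕ, steenrod p n k x ∈ M)
    (hNP : ∀ x ∈ N, ∀ k : ℕ, steenrod p n k x ∈ N)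
    (hsum : M ⊔ N = DicksonPlus p n) (hdisj : M ⊓ N = ⊥) :
    M = ⊥ ∨ N = ⊥ := by
  cases n with
  | zero =>
    refine Or.inl ((Submodule.eq_bot_iff M).2 fun x hx => ?_)
    obtain ⟨F, rfl, hF⟩ := exists_dicksonEval_eq (hM hx)
    rw [eq_C_of_isEmpty F, notMem_support_iff.1 hF, C_0, map_zero]
  | succ n =>
    by_contra! hne
    obtain ⟨b, hb⟩ := SteenrodStable.exists_pow_mem_of_ne_bot hMP hM hne.1
    obtain ⟨c, hc⟩ := SteenrodStable.exists_pow_mem_of_ne_bot hNP hN hne.2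
    have hmem : dicksonCoeff p (n + 1) 0 ^ p ^ max b c ∈ M ⊓ N :=
      ⟨SteenrodStable.dicksonCoeff_zero_pow_mem_of_le hMP (le_max_left b c) hb,
        SteenrodStable.dicksonCoeff_zero_pow_mem_of_le hNP (le_max_right b c) hc⟩
    rw [hdisj, Submodule.mem_bot] at hmem
    exact pow_ne_zero _ (dicksonCoeff_zero_ne_zero p (n + 1)) hmem
end
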